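/- arXiv:2306.05305 — 8 statements merged into one kernel-verified Lean document; each statement's English description precedes it below -/
import Mathlib

section
/- Multiscale decomposition, first slicing inequality: there exists a numerical constant C > 0 such that for every dimension d ≥ 1 and every ℓ ∈ (0,4] there is a constant K > 0 (depending only on ℓ and d) such that for all m ∈ ℤ^d one has ⟨m⟩^{-2ℓ} ≤ K · Σ_{k ≥ -1} 2^{-2kℓ} · exp( -C · 2^{-k} · Σ_{c=1}^d |m_c| ). -/
/-- The terms of the multiscale sum are summable, being dominated by a geometric series. -/
theorem summable_multiscale {ℓ S : ℝ} (hℓ : 0 < ℓ) (hS : 0 ≤ S) :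
    Summable fun j : ℕ => (2 : ℝ) ^ (-2 * ((j : ℝ) - 1) * ℓ) *
      Real.exp (-1 * (2 : ℝ) ^ (-((j : ℝ) - 1)) * S) := by
  have hr : (2 : ℝ) ^ (-2 * ℓ) < 1 :=
    Real.rpow_lt_one_of_one_lt_of_neg (by norm_num) (by linarith)
  refine Summable.of_nonneg_of_le (fun j => by positivity) (fun j => ?_)
    ((summable_geometric_of_lt_one (by positivity) hr).mul_left ((2 : ℝ) ^ (2 * ℓ)))
  have hexp : Real.exp (-1 * (2 : ℝ) ^ (-((j : ℝ) - 1)) * S) ≤ 1 := by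
    rw [Real.exp_le_one_iff]
    have : 0 ≤ (2 : ℝ) ^ (-((j : ℝ) - 1)) * S := by positivity
    linarith
  refine (mul_le_of_le_one_right (by positivity) hexp).trans_eq ?_
  rw [← Real.rpow_natCast, ← Real.rpow_mul (by norm_num), ← Real.rpow_add (by norm_num)]
  ring_nf


/-- **Multiscale decomposition, first slicing inequality.**
There exists a numerical constant `C > 0` such that for every dimension `d ≥ 1` and every
`ℓ ∈ (0,4]` there is a constant `K > 0` (depending only on `ℓ` and `d`) such that for all
`m ∈ ℤ^d` one has
`⟨m⟩^{-2ℓ} ≤ K · Σ_{k ≥ -1} 2^{-2kℓ} · exp(-C · 2^{-k} · Σ_{c=1}^d |m_c|)`,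
where `⟨m⟩ = (1+|m|²)^{1/2}` so that `⟨m⟩^{-2ℓ} = (1+|m|²)^{-ℓ}`.  The sum over `k ≥ -1`
is written as a sum over `j : ℕ` with `k = j - 1`. -/
theorem stmt0 :
    ∃ C : ℝ, 0 < C ∧
      ∀ d : ℕ, 1 ≤ d → ∀ ℓ : ℝ, 0 < ℓ → ℓ ≤ 4 →
        ∃ K : ℝ, 0 < K ∧
          ∀ m : Fin d → ℤ,
            (1 + ∑ i, (m i : ℝ) ^ 2) ^ (-ℓ) ≤
              K * ∑' j : ℕ,
                (2 : ℝ) ^ (-2 * ((j : ℝ) - 1) * ℓ) *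
                  Real.exp (-C * (2 : ℝ) ^ (-((j : ℝ) - 1)) * ∑ i, |(m i : ℝ)|) := by
  refine ⟨1, one_pos, fun d _ ℓ hℓ _ => ⟨4 ^ ℓ * Real.exp d, by positivity, fun m => ?_⟩⟩
  set B : ℝ := 1 + ∑ i, (m i : ℝ) ^ 2 with hB
  have hB1 : 1 ≤ B := le_add_of_nonneg_right (Finset.sum_nonneg fun i _ => sq_nonneg _)
  obtain ⟨n, hn, hn'⟩ := exists_nat_pow_near hB1 (by norm_num : (1 : ℝ) < 4)
  have hpow : ((2 : ℝ) ^ (n + 1)) ^ 2 = 4 ^ (n + 1) := by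
    rw [← pow_mul, mul_comm, pow_mul]
    norm_num
  have hm : ∀ i, |(m i : ℝ)| ≤ 2 ^ (n + 1) := fun i => by
    refine abs_le_of_sq_le_sq ?_ (by positivity)
    have := Finset.single_le_sum (f := fun i => (m i : ℝ) ^ 2)
      (fun i _ => sq_nonneg _) (Finset.mem_univ i)
    linarith
  have hsum : ∑ i, |(m i : ℝ)| ≤ d * 2 ^ (n + 1) := by
    simpa using Finset.sum_le_card_nsmul Finset.univ _ _ fun i _ => hm i
  have hk : ((n + 2 : ℕ) : ℝ) - 1 = ((n + 1 : ℕ) : ℝ) := by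
    push_cast
    ring
  have hle := Summable.le_tsum (summable_multiscale hℓ
    (Finset.sum_nonneg (s := Finset.univ) fun i _ => abs_nonneg (m i : ℝ)))
    (n + 2) (fun j _ => by positivity)
  refine le_trans ?_ (mul_le_mul_of_nonneg_left hle (by positivity))
  rw [hk]
  have hscale : (4 * B) ^ (-ℓ) ≤ (2 : ℝ) ^ (-2 * ((n + 1 : ℕ) : ℝ) * ℓ) := by
    have : (2 : ℝ) ^ (-2 * ((n + 1 : ℕ) : ℝ) * ℓ) = ((4 : ℝ) ^ (n + 1)) ^ (-ℓ) := by
      rw [← hpow, ← pow_mul, ← Real.rpow_natCast, ← Real.rpow_mul (by norm_num)]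
      push_cast
      ring_nf
    rw [this]
    refine Real.rpow_le_rpow_of_nonpos (by positivity) ?_ (by linarith)
    rw [pow_succ]
    linarith
  have hexp : Real.exp (-d) ≤
      Real.exp (-1 * (2 : ℝ) ^ (-((n + 1 : ℕ) : ℝ)) * ∑ i, |(m i : ℝ)|) := by
    rw [Real.exp_le_exp, Real.rpow_neg (by norm_num), Real.rpow_natCast]
    have : ((2 : ℝ) ^ (n + 1))⁻¹ * ∑ i, |(m i : ℝ)| ≤ d := by
      rw [inv_mul_le_iff₀ (by positivity), mul_comm]
      exact hsum
    linarith
  calc B ^ (-ℓ) = 4 ^ ℓ * Real.exp d * ((4 * B) ^ (-ℓ) * Real.exp (-d)) := by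
        rw [Real.mul_rpow (by norm_num) (by linarith), Real.rpow_neg (zero_le_four (α := ℝ)) ℓ,
          Real.exp_neg]
        field_simp
    _ ≤ _ := by gcongr
end

section
/- Multiscale decomposition, second slicing inequality: there exists a numerical constant C > 0 such that for every dimension d ≥ 1 and every ℓ ∈ [0,4] there is a constant K > 0 (depending only on ℓ and d) such that for all integers k₀ ≥ 0 and all m ∈ ℤ^d one has exp( -2^{-2k₀} ⟨m⟩² ) · ⟨m⟩^{-2ℓ} ≤ K · Σ_{k = -1}^{k₀ - 1} 2^{-2kℓ} · exp( -C · 2^{-k} · Σ_{c=1}^d |m_c| ). -/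
/-- A Gaussian exponent in the Euclidean norm dominates a linear exponent in the `ℓ¹` norm. -/
lemma two_mul_l1_le {d : ℕ} (hd : 1 ≤ d) (x : Fin d → ℝ) (a : ℝ) :
    2 * a * ∑ i, |x i| ≤ d + a ^ 2 * (1 + ∑ i, x i ^ 2) := by
  have hd' : (0 : ℝ) < d := by exact_mod_cast hd
  have hcs : (∑ i, |x i|) ^ 2 ≤ d * ∑ i, x i ^ 2 := by
    simpa using sq_sum_le_card_mul_sum_sq (s := Finset.univ) (f := fun i => |x i|)
  refine le_of_mul_le_mul_left ?_ hd'
  nlinarith [sq_nonneg (a * ∑ i, |x i| - d), mul_le_mul_of_nonneg_left hcs (sq_nonneg a),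
    mul_nonneg hd'.le (sq_nonneg a)]

/-- Every `Q ≥ 1` lies above a dyadic scale `4 ^ j` with `j ≤ k`, and either `j = k` or `Q` is
comparable to `4 ^ j`. -/
lemma exists_dyadic_scale {Q : ℝ} (hQ : 1 ≤ Q) (k : ℕ) :
    ∃ j ≤ k, (4 : ℝ) ^ j ≤ Q ∧ (j = k ∨ Q ≤ 4 * 4 ^ j) := by
  obtain ⟨n, hn, hn'⟩ := exists_nat_pow_near hQ (by norm_num : (1 : ℝ) < 4)
  rcases le_total n k with h | h
  · exact ⟨n, h, hn, Or.inr (by rw [pow_succ] at hn'; linarith)⟩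
  · exact ⟨k, le_rfl, (pow_le_pow_right₀ (by norm_num) h).trans hn, Or.inl rfl⟩

/-- **Multiscale decomposition, second slicing inequality.**
There exists a numerical constant `C > 0` such that for every dimension `d ≥ 1` and every
`ℓ ∈ [0,4]` there is a constant `K > 0` (depending only on `ℓ` and `d`) such that for all
integers `k₀ ≥ 0` and all `m ∈ ℤ^d` one has
`exp(-2^{-2k₀}⟨m⟩²) · ⟨m⟩^{-2ℓ} ≤ K · Σ_{k=-1}^{k₀-1} 2^{-2kℓ} · exp(-C·2^{-k}·Σ_c |m_c|)`,
where `⟨m⟩² = 1+|m|²`.  The finite sum over `-1 ≤ k ≤ k₀-1` is written as a sum over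
`j ∈ {0,…,k₀}` with `k = j - 1`. -/
theorem stmt1 :
    ∃ C : ℝ, 0 < C ∧
      ∀ d : ℕ, 1 ≤ d → ∀ ℓ : ℝ, 0 ≤ ℓ → ℓ ≤ 4 →
        ∃ K : ℝ, 0 < K ∧
          ∀ (k₀ : ℕ) (m : Fin d → ℤ),
            Real.exp (-(2 : ℝ) ^ (-2 * (k₀ : ℝ)) * (1 + ∑ i, (m i : ℝ) ^ 2)) *
                (1 + ∑ i, (m i : ℝ) ^ 2) ^ (-ℓ) ≤
              K * ∑ j ∈ Finset.range (k₀ + 1),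
                (2 : ℝ) ^ (-2 * ((j : ℝ) - 1) * ℓ) *
                  Real.exp (-C * (2 : ℝ) ^ (-((j : ℝ) - 1)) * ∑ i, |(m i : ℝ)|) := by
  refine ⟨1, one_pos, fun d hd ℓ hℓ _ => ⟨Real.exp (d + 4), Real.exp_pos _, fun k₀ m => ?_⟩⟩
  set Q : ℝ := 1 + ∑ i, (m i : ℝ) ^ 2 with hQdef
  have hQ : 1 ≤ Q := le_add_of_nonneg_right (Finset.sum_nonneg fun i _ => sq_nonneg _)
  obtain ⟨j, hjk, hjQ, hj⟩ := exists_dyadic_scale hQ k₀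
  have hsq (n : ℕ) : (2 : ℝ) ^ (-2 * (n : ℝ)) = ((2 : ℝ) ^ (-(n : ℝ))) ^ 2 := by
    rw [← Real.rpow_natCast, ← Real.rpow_mul (by norm_num)]
    congr 1
    push_cast
    ring
  have hinv : ((2 : ℝ) ^ (-(j : ℝ))) ^ 2 * 4 ^ j = 1 := by
    rw [Real.rpow_neg (by norm_num), Real.rpow_natCast, inv_pow, ← pow_mul, mul_comm j 2, pow_mul]
    norm_num
  have hshift : (2 : ℝ) ^ (-((j : ℝ) - 1)) = 2 * 2 ^ (-(j : ℝ)) := by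
    rw [neg_sub, sub_eq_add_neg, Real.rpow_add (by norm_num), Real.rpow_one]
  have hexp : -(2 : ℝ) ^ (-2 * (k₀ : ℝ)) * Q ≤
      (d + 4) + -1 * (2 : ℝ) ^ (-((j : ℝ) - 1)) * ∑ i, |(m i : ℝ)| := by
    have hlin := two_mul_l1_le hd (fun i => (m i : ℝ)) ((2 : ℝ) ^ (-(j : ℝ)))
    rw [← hQdef] at hlin
    rw [hshift, hsq]
    rcases hj with rfl | hj
    · linarith
    · have h1 := mul_le_mul_of_nonneg_left hj (sq_nonneg ((2 : ℝ) ^ (-(j : ℝ))))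
      have h2 : 0 ≤ ((2 : ℝ) ^ (-(k₀ : ℝ))) ^ 2 * Q := by positivity
      linarith
  have hpow : Q ^ (-ℓ) ≤ (2 : ℝ) ^ (-2 * ((j : ℝ) - 1) * ℓ) := by
    calc Q ^ (-ℓ) ≤ ((4 : ℝ) ^ j) ^ (-ℓ) :=
          Real.rpow_le_rpow_of_nonpos (by positivity) hjQ (neg_nonpos.2 hℓ)
      _ = (2 : ℝ) ^ (-2 * (j : ℝ) * ℓ) := by
          rw [show (4 : ℝ) = 2 ^ 2 by norm_num, ← pow_mul, ← Real.rpow_natCast,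
            ← Real.rpow_mul (by norm_num)]
          congr 1
          push_cast
          ring
      _ ≤ _ := Real.rpow_le_rpow_of_exponent_le (by norm_num) (by nlinarith)
  calc _ ≤ Real.exp ((d + 4) + -1 * (2 : ℝ) ^ (-((j : ℝ) - 1)) * ∑ i, |(m i : ℝ)|) *
        (2 : ℝ) ^ (-2 * ((j : ℝ) - 1) * ℓ) := by gcongr
    _ = Real.exp (d + 4) * ((2 : ℝ) ^ (-2 * ((j : ℝ) - 1) * ℓ) *
        Real.exp (-1 * (2 : ℝ) ^ (-((j : ℝ) - 1)) * ∑ i, |(m i : ℝ)|)) := by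
      rw [Real.exp_add]
      ring
    _ ≤ _ := by
      refine mul_le_mul_of_nonneg_left ?_ (Real.exp_pos _).le
      exact Finset.single_le_sum
        (f := fun i : ℕ => (2 : ℝ) ^ (-2 * ((i : ℝ) - 1) * ℓ) *
          Real.exp (-1 * (2 : ℝ) ^ (-((i : ℝ) - 1)) * ∑ c, |(m c : ℝ)|))
        (fun i _ => by positivity) (Finset.mem_range.2 (Nat.lt_succ_of_le hjk))
end

section
/- Fixed-time bound for a time non-local operator: assume S := sup_{(u,t) ∈ Simp_T} (t−u)^η ‖τ_{u,t}‖_{L(E,F)} < ∞. Then for every continuous f : [0,T] → E and every t ∈ [0,T], the Bochner integral τ(f)(t) = ∫₀ᵗ τ_{u,t}(f(u)) du exists and ‖τ(f)(t)‖_F ≤ (2/(θ−κ)) · t^{(θ−κ)/2} · S · ‖f‖. -/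
open MeasureTheory

/-- The reflected power `u ↦ (t - u) ^ (a - 1)` with `0 < a` is integrable up to `t`. -/
theorem intervalIntegrable_sub_rpow {a : ℝ} (ha : 0 < a) (t : ℝ) :
    IntervalIntegrable (fun u : ℝ => (t - u) ^ (a - 1)) volume 0 t := by
  have h := (intervalIntegral.intervalIntegrable_rpow' (a := 0) (b := t)
    (r := a - 1) (by linarith)).comp_sub_left t
  simpa using h.symm

/-- The integral of the reflected power `u ↦ (t - u) ^ (a - 1)` over `[0, t]`. -/
theorem integral_sub_rpow {a : ℝ} (ha : 0 < a) (t : ℝ) :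
    ∫ u in (0 : ℝ)..t, (t - u) ^ (a - 1) = t ^ a / a := by
  rw [intervalIntegral.integral_comp_sub_left (fun x : ℝ => x ^ (a - 1)) t, sub_self, sub_zero,
    integral_rpow (Or.inl (by linarith)), sub_add_cancel, Real.zero_rpow ha.ne', sub_zero]

/-- **Fixed-time bound for a time non-local operator.**
Let `E, F` be real Banach spaces, `T > 0`, `κ > 0`, `θ ∈ (κ, 2+κ)`, and
`η := 1 - (θ-κ)/2 ∈ (0,1)`.  Let `τ : Simp_T → L(E,F)` be continuous in operator norm on
`Simp_T = {(u,t) : 0 ≤ u < t ≤ T}` and assume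
`S := sup_{(u,t) ∈ Simp_T} (t-u)^η ‖τ_{u,t}‖ < ∞` (formalized: `S` is an upper bound).
Then for every continuous `f : [0,T] → E` and every `t ∈ [0,T]`, the Bochner integral
`τ(f)(t) = ∫₀ᵗ τ_{u,t}(f(u)) du` exists and
`‖τ(f)(t)‖_F ≤ (2/(θ-κ)) · t^{(θ-κ)/2} · S · ‖f‖_∞`. -/
theorem stmt4
    {E F : Type*} [NormedAddCommGroup E] [NormedSpace ℝ E]
    [NormedAddCommGroup F] [NormedSpace ℝ F] [CompleteSpace F]
    (T κ θ : ℝ) (hT : 0 < T) (hκ : 0 < κ) (hθκ : κ < θ) (hθ : θ < 2 + κ)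
    (τ : ℝ → ℝ → E →L[ℝ] F)
    (hτ : ContinuousOn (fun p : ℝ × ℝ => τ p.1 p.2)
      {p : ℝ × ℝ | 0 ≤ p.1 ∧ p.1 < p.2 ∧ p.2 ≤ T})
    (S : ℝ)
    (hS : ∀ u t : ℝ, 0 ≤ u → u < t → t ≤ T →
      (t - u) ^ (1 - (θ - κ) / 2) * ‖τ u t‖ ≤ S)
    (f : ℝ → E) (hf : ContinuousOn f (Set.Icc 0 T))
    (t : ℝ) (ht : t ∈ Set.Icc (0 : ℝ) T) :
    IntervalIntegrable (fun u => τ u t (f u)) volume 0 t ∧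
      ‖∫ u in (0 : ℝ)..t, τ u t (f u)‖ ≤
        2 / (θ - κ) * t ^ ((θ - κ) / 2) * S * ⨆ s : Set.Icc (0 : ℝ) T, ‖f (s : ℝ)‖ := by
  obtain ⟨ht0, htT⟩ := ht
  set M : ℝ := ⨆ s : Set.Icc (0 : ℝ) T, ‖f (s : ℝ)‖
  have hbdd : BddAbove (Set.range fun s : Set.Icc (0 : ℝ) T => ‖f (s : ℝ)‖) := by
    have := (isCompact_Icc.image_of_continuousOn hf.norm).bddAbove
    rwa [Set.image_eq_range] at this
  have hfM : ∀ s ∈ Set.Icc (0 : ℝ) T, ‖f s‖ ≤ M := fun s hs => le_ciSup hbdd ⟨s, hs⟩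
  have ha : 0 < (θ - κ) / 2 := by linarith
  have hbound : ∀ u, 0 ≤ u → u < t →
      ‖τ u t (f u)‖ ≤ (t - u) ^ ((θ - κ) / 2 - 1) * (S * M) := by
    intro u hu hut
    have hpos : 0 < (t - u) ^ (1 - (θ - κ) / 2) := Real.rpow_pos_of_pos (sub_pos.2 hut) _
    have hτu : ‖τ u t‖ ≤ (t - u) ^ ((θ - κ) / 2 - 1) * S := by
      rw [← neg_sub 1, Real.rpow_neg (sub_pos.2 hut).le, ← div_eq_inv_mul, le_div_iff₀' hpos]
      exact hS u t hu hut htT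
    calc ‖τ u t (f u)‖ ≤ ‖τ u t‖ * ‖f u‖ := (τ u t).le_opNorm _
      _ ≤ (t - u) ^ ((θ - κ) / 2 - 1) * S * M :=
        mul_le_mul hτu (hfM u ⟨hu, hut.le.trans htT⟩) (norm_nonneg _)
          ((norm_nonneg _).trans hτu)
      _ = _ := mul_assoc _ _ _
  have hae : ∀ᵐ u ∂(volume : Measure ℝ), u ∈ Set.Ioc 0 t →
      ‖τ u t (f u)‖ ≤ (t - u) ^ ((θ - κ) / 2 - 1) * (S * M) := by
    filter_upwards [Measure.ae_ne volume t] with u hne hu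
    exact hbound u hu.1.le (lt_of_le_of_ne hu.2 hne)
  have hint : IntervalIntegrable (fun u : ℝ => (t - u) ^ ((θ - κ) / 2 - 1) * (S * M))
      volume 0 t := (intervalIntegrable_sub_rpow ha t).mul_const _
  have hcont : ContinuousOn (fun u => τ u t (f u)) (Set.Ioo 0 t) := by
    refine ContinuousOn.clm_apply (hτ.comp (f := fun u => (u, t)) (by fun_prop) ?_)
      (hf.mono fun u hu => ⟨hu.1.le, hu.2.le.trans htT⟩)
    exact fun u hu => ⟨hu.1.le, hu.2, htT⟩
  have hmeas : AEStronglyMeasurable (fun u => τ u t (f u))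
      (volume.restrict (Set.uIoc 0 t)) := by
    rw [Set.uIoc_of_le ht0, ← restrict_Ioo_eq_restrict_Ioc]
    exact hcont.aestronglyMeasurable measurableSet_Ioo
  refine ⟨hint.mono_fun' hmeas ?_, ?_⟩
  · rw [Set.uIoc_of_le ht0]
    exact (ae_restrict_iff' measurableSet_Ioc).2 hae
  · refine (intervalIntegral.norm_integral_le_of_norm_le ht0 hae hint).trans_eq ?_
    rw [intervalIntegral.integral_mul_const, integral_sub_rpow ha]
    have : θ - κ ≠ 0 := by linarith
    field_simp
end

section
/- M⁴_c–Sobolev embedding: for every α > 1/4 and every finitely supported f : ℤ^{d−1} × ℤ → ℂ, one has Σ_{(w,a) ∈ ℤ^{d−1} × ℤ} |f(w,a)|² ≤ ( Σ_{a ∈ ℤ} ⟨a⟩^{−4α} )^{1/2} · ( Σ_{a,b ∈ ℤ} ⟨a⟩^{2α} ⟨b⟩^{2α} |M_f(a,b)|² )^{1/2}, where the constant Σ_{a ∈ ℤ} ⟨a⟩^{−4α} is finite; in the notation of the paper, ‖u‖_{L²} ≲ ‖⟨∇_c⟩^α u‖_{M⁴_c}. -/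
noncomputable section

/-- The Gram matrix `M_f(a,b) = Σ_{w ∈ ℤ^{d-1}} f(w,a) · conj(f(w,b))` of the Fourier
coefficients `f : ℤ^{d-1} × ℤ → ℂ` of a trigonometric polynomial `u` on `𝕋^d`
(identifying `ℤ^d ≅ ℤ^{d-1} × ℤ` via the distinguished coordinate `c`). -/
def Mf (d : ℕ) (f : ((Fin (d - 1) → ℤ) × ℤ) → ℂ) (a b : ℤ) : ℂ :=
  ∑' w : Fin (d - 1) → ℤ, f (w, a) * (starRingEnd ℂ) (f (w, b))

/-- The constant `Σ_a ⟨a⟩^{-4α}` is finite for `α > 1/4`. -/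
theorem summable_one_add_sq_rpow {α : ℝ} (hα : 1 / 4 < α) :
    Summable (fun a : ℤ => (1 + (a : ℝ) ^ 2) ^ (-(2 * α))) := by
  refine Summable.of_norm_bounded_eventually
    (Real.summable_abs_int_rpow (b := 4 * α) (by linarith)) ?_
  filter_upwards [(Set.finite_singleton (0 : ℤ)).compl_mem_cofinite] with a ha
  have ha : (0 : ℝ) < |(a : ℝ)| := abs_pos.2 (Int.cast_ne_zero.2 ha)
  have h : |(a : ℝ)| ^ (-(4 * α)) = ((a : ℝ) ^ 2) ^ (-(2 * α)) := by
    rw [← sq_abs, ← Real.rpow_natCast, ← Real.rpow_mul ha.le]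
    congr 1
    push_cast
    ring
  rw [Real.norm_of_nonneg (by positivity), h]
  exact Real.rpow_le_rpow_of_nonpos (by rw [← sq_abs]; positivity) (by linarith) (by linarith)

/-- The diagonal of the Gram matrix consists of the squared `ℓ²` norms of the fibres. -/
theorem Mf_self (d : ℕ) (f : ((Fin (d - 1) → ℤ) × ℤ) → ℂ) (a : ℤ) :
    Mf d f a a = ((∑' w, ‖f (w, a)‖ ^ 2 : ℝ) : ℂ) := by
  simp only [Mf, Complex.mul_conj', Complex.ofReal_tsum, Complex.ofReal_pow]

theorem norm_Mf_self (d : ℕ) (f : ((Fin (d - 1) → ℤ) × ℤ) → ℂ) (a : ℤ) :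
    ‖Mf d f a a‖ = ∑' w, ‖f (w, a)‖ ^ 2 := by
  rw [Mf_self, Complex.norm_real, Real.norm_of_nonneg (tsum_nonneg fun _ => by positivity)]

/-- The Gram matrix vanishes as soon as one of its two fibres does. -/
theorem Mf_eq_zero (d : ℕ) (f : ((Fin (d - 1) → ℤ) × ℤ) → ℂ) {a b : ℤ}
    (h : (∀ w, f (w, a) = 0) ∨ ∀ w, f (w, b) = 0) : Mf d f a b = 0 := by
  rcases h with h | h <;> simp [Mf, h]

/-- **`M⁴_c`–Sobolev embedding.**
For every `α > 1/4` and every finitely supported `f : ℤ^{d-1} × ℤ → ℂ`, one has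
`Σ_{(w,a)} |f(w,a)|² ≤ (Σ_a ⟨a⟩^{-4α})^{1/2} · (Σ_{a,b} ⟨a⟩^{2α}⟨b⟩^{2α}|M_f(a,b)|²)^{1/2}`,
where the constant `Σ_a ⟨a⟩^{-4α}` is finite; in the notation of the paper,
`‖u‖_{L²} ≲ ‖⟨∇_c⟩^α u‖_{M⁴_c}`.  Here `⟨a⟩^{-4α} = (1+a²)^{-2α}` and, by Parseval,
`‖u‖_{L²}² = Σ_{(w,a)} |f(w,a)|²`. -/
theorem stmt10 (d : ℕ) (hd : 2 ≤ d) (α : ℝ) (hα : 1 / 4 < α)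
    (f : ((Fin (d - 1) → ℤ) × ℤ) → ℂ) (hf : (Function.support f).Finite) :
    Summable (fun a : ℤ => (1 + (a : ℝ) ^ 2) ^ (-(2 * α))) ∧
      (∑' p : (Fin (d - 1) → ℤ) × ℤ, ‖f p‖ ^ 2) ≤
        (∑' a : ℤ, (1 + (a : ℝ) ^ 2) ^ (-(2 * α))) ^ ((1 : ℝ) / 2) *
          (∑' p : ℤ × ℤ, (1 + (p.1 : ℝ) ^ 2) ^ α * (1 + (p.2 : ℝ) ^ 2) ^ α *
            ‖Mf d f p.1 p.2‖ ^ 2) ^ ((1 : ℝ) / 2) := by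
  have hsum := summable_one_add_sq_rpow hα
  refine ⟨hsum, ?_⟩
  set s : Finset ℤ := hf.toFinset.image Prod.snd with hs
  have hs0 : ∀ a ∉ s, ∀ w, f (w, a) = 0 := by
    intro a ha w
    by_contra h
    exact ha (Finset.mem_image.2 ⟨(w, a), by simpa using h, rfl⟩)
  have hpos (a : ℤ) : (0 : ℝ) < 1 + (a : ℝ) ^ 2 := by positivity
  have hsq (a : ℤ) (β : ℝ) : ((1 + (a : ℝ) ^ 2) ^ β) ^ 2 = (1 + (a : ℝ) ^ 2) ^ (2 * β) := by
    rw [← Real.rpow_natCast, ← Real.rpow_mul (hpos a).le, mul_comm, Nat.cast_ofNat]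
  have hL2 : ∑' p : (Fin (d - 1) → ℤ) × ℤ, ‖f p‖ ^ 2 = ∑ a ∈ s, ‖Mf d f a a‖ := by
    have hfs : Summable fun p : ℤ × (Fin (d - 1) → ℤ) => ‖f p.swap‖ ^ 2 := by
      refine summable_of_hasFiniteSupport ((hf.preimage Prod.swap_injective.injOn).subset ?_)
      intro p hp
      simpa using hp
    rw [← (Equiv.prodComm ℤ (Fin (d - 1) → ℤ)).tsum_eq]
    simp only [Equiv.prodComm_apply]
    rw [hfs.tsum_prod]
    simp only [Prod.swap_prod_mk, ← norm_Mf_self]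
    exact tsum_eq_sum fun a ha => by rw [Mf_eq_zero d f (.inl (hs0 a ha)), norm_zero]
  set F : ℤ × ℤ → ℝ := fun p =>
    (1 + (p.1 : ℝ) ^ 2) ^ α * (1 + (p.2 : ℝ) ^ 2) ^ α * ‖Mf d f p.1 p.2‖ ^ 2 with hF
  have hF0 (p : ℤ × ℤ) : 0 ≤ F p := by positivity
  have hFs : Summable F := by
    refine summable_of_ne_finset_zero (s := s ×ˢ s) fun p hp => ?_
    have h : Mf d f p.1 p.2 = 0 := by
      rw [Finset.mem_product, not_and_or] at hp
      exact Mf_eq_zero d f (hp.imp (hs0 _) (hs0 _))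
    simp [hF, h]
  have hdiag : ∑ a ∈ s, ((1 + (a : ℝ) ^ 2) ^ α * ‖Mf d f a a‖) ^ 2 ≤ ∑' p, F p := by
    calc ∑ a ∈ s, ((1 + (a : ℝ) ^ 2) ^ α * ‖Mf d f a a‖) ^ 2
        = ∑ p ∈ s.image fun a => (a, a), F p := by
          rw [Finset.sum_image fun a _ b _ h => (Prod.ext_iff.1 h).1]
          exact Finset.sum_congr rfl fun a _ => by simp only [hF]; ring
      _ ≤ ∑' p, F p := hFs.sum_le_tsum _ fun p _ => hF0 p
  rw [hL2, ← Real.sqrt_eq_rpow, ← Real.sqrt_eq_rpow]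
  calc ∑ a ∈ s, ‖Mf d f a a‖
      = ∑ a ∈ s, (1 + (a : ℝ) ^ 2) ^ (-α) * ((1 + (a : ℝ) ^ 2) ^ α * ‖Mf d f a a‖) := by
        refine Finset.sum_congr rfl fun a _ => ?_
        rw [← mul_assoc, ← Real.rpow_add (hpos a), neg_add_cancel, Real.rpow_zero, one_mul]
    _ ≤ √(∑ a ∈ s, ((1 + (a : ℝ) ^ 2) ^ (-α)) ^ 2) *
          √(∑ a ∈ s, ((1 + (a : ℝ) ^ 2) ^ α * ‖Mf d f a a‖) ^ 2) :=
        Real.sum_mul_le_sqrt_mul_sqrt _ _ _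
    _ ≤ _ := by
        gcongr
        simp only [hsq, mul_neg]
        exact hsum.sum_le_tsum _ fun a _ => Real.rpow_nonneg (hpos a).le _

end
end

section
/- M⁴_c–Sobolev interpolation with the H¹ norm: for every θ ∈ (1/4, 1] there is a constant C_θ (depending only on θ) such that for every finitely supported f : ℤ^{d−1} × ℤ → ℂ one has ‖u‖_{L²} ≤ C_θ · ‖u‖_{M⁴_c}^{1−θ} · ‖u‖_{H¹}^{θ}, where ‖u‖_{L²}² = Σ_{(w,a)} |f(w,a)|², ‖u‖_{M⁴_c}⁴ = Σ_{a,b ∈ ℤ} |M_f(a,b)|², and ‖u‖_{H¹}² = Σ_{(w,a)} (1 + |w|² + a²) |f(w,a)|². -/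
noncomputable section

/-- Discrete Carlson-type inequality on `ℤ`: an `ℓ¹` sum is controlled by the `ℓ²` norm and the
second moment. -/
theorem sum_pow_five_le (S : Finset ℤ) (x : ℤ → ℝ) (hx : ∀ a, 0 ≤ x a) :
    (∑ a ∈ S, x a) ^ 5 ≤
      512 * (∑ a ∈ S, x a ^ 2) ^ 2 * (∑ a ∈ S, (1 + (a : ℝ) ^ 2) * x a) := by
  set L := ∑ a ∈ S, x a with hL
  set A := ∑ a ∈ S, x a ^ 2 with hA
  set H := ∑ a ∈ S, (1 + (a : ℝ) ^ 2) * x a with hH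
  have hL0 : 0 ≤ L := Finset.sum_nonneg fun a _ => hx a
  have hA0 : 0 ≤ A := Finset.sum_nonneg fun a _ => sq_nonneg _
  have hLH : L ≤ H := Finset.sum_le_sum fun a _ => by nlinarith [hx a, sq_nonneg (a : ℝ)]
  rcases hL0.eq_or_lt with h0 | hpos
  · rw [← h0] at hLH ⊢
    have : 0 ≤ 512 * A ^ 2 * H := by positivity
    simpa using this
  have hHpos : 0 < H := hpos.trans_le hLH
  set r := √(2 * H / L) with hr
  have hr2 : r ^ 2 = 2 * H / L := Real.sq_sqrt (by positivity)
  have hr2L : r ^ 2 * L = 2 * H := by rw [hr2]; field_simp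
  have hr0 : 0 ≤ r := Real.sqrt_nonneg _
  have hr1 : 1 ≤ r := by
    by_contra! h
    have h1 : r ^ 2 ≤ 1 := pow_le_one₀ hr0 h.le
    nlinarith
  set N := ⌈r⌉₊ with hN
  have hNr : r ≤ N := Nat.le_ceil r
  have hN2 : (N : ℝ) ≤ 2 * r := by linarith [Nat.ceil_lt_add_one hr0]
  have hsplit := Finset.sum_filter_add_sum_filter_not S (fun a : ℤ => |a| < (N : ℤ)) x
  set B := ∑ a ∈ S with |a| < (N : ℤ), x a with hB
  set D := ∑ a ∈ S with ¬|a| < (N : ℤ), x a with hD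
  have hB0 : 0 ≤ B := Finset.sum_nonneg fun a _ => hx a
  have hlow : B ^ 2 ≤ 2 * N * A := by
    have hcard : ((S.filter fun a : ℤ => |a| < (N : ℤ)).card : ℝ) ≤ 2 * N := by
      have hsub : (S.filter fun a : ℤ => |a| < (N : ℤ)) ⊆ Finset.Ioo (-(N : ℤ)) N := by
        intro a ha
        rw [Finset.mem_filter, abs_lt] at ha
        exact Finset.mem_Ioo.2 ha.2
      have h := Finset.card_le_card hsub
      rw [Int.card_Ioo] at h
      have h' : (S.filter fun a : ℤ => |a| < (N : ℤ)).card ≤ 2 * N := by omega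
      exact_mod_cast h'
    calc B ^ 2 ≤ _ := sq_sum_le_card_mul_sum_sq
      _ ≤ 2 * N * A := mul_le_mul hcard
          (Finset.sum_le_sum_of_subset_of_nonneg (Finset.filter_subset _ _)
            fun a _ _ => sq_nonneg _)
          (Finset.sum_nonneg fun a _ => sq_nonneg _) (by positivity)
  have hhigh : (N : ℝ) ^ 2 * D ≤ H := by
    rw [hD, Finset.mul_sum]
    refine le_trans (Finset.sum_le_sum fun a ha => ?_)
      (Finset.sum_le_sum_of_subset_of_nonneg (Finset.filter_subset _ _)
        fun a _ _ => mul_nonneg (by positivity) (hx a))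
    rw [Finset.mem_filter, not_lt] at ha
    have h : (N : ℝ) ≤ |(a : ℝ)| := by exact_mod_cast ha.2
    have h2 : (N : ℝ) ^ 2 ≤ (a : ℝ) ^ 2 := by
      rw [← sq_abs (a : ℝ)]
      gcongr
    exact mul_le_mul_of_nonneg_right (by linarith) (hx a)
  have hD0 : 0 ≤ D := Finset.sum_nonneg fun a _ => hx a
  have hDL : D ≤ L / 2 := by
    have h : r ^ 2 * D ≤ r ^ 2 * (L / 2) :=
      calc r ^ 2 * D ≤ (N : ℝ) ^ 2 * D := by gcongr
        _ ≤ H := hhigh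
        _ = r ^ 2 * (L / 2) := by linarith
    exact le_of_mul_le_mul_left h (by positivity)
  have hLB : L ≤ 2 * B := by linarith
  have hLsq : L ^ 2 ≤ 16 * (r * A) :=
    calc L ^ 2 ≤ (2 * B) ^ 2 := by gcongr
      _ = 4 * B ^ 2 := by ring
      _ ≤ 4 * (2 * N * A) := by gcongr
      _ ≤ 4 * (2 * (2 * r) * A) := by gcongr
      _ = 16 * (r * A) := by ring
  calc L ^ 5 = (L ^ 2) ^ 2 * L := by ring
    _ ≤ (16 * (r * A)) ^ 2 * L := by gcongr
    _ = 256 * A ^ 2 * (r ^ 2 * L) := by ring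
    _ = 512 * A ^ 2 * H := by rw [hr2L]; ring

/-- Interpolating `L ^ 5 ≤ K A² H` with `L ≤ H`. -/
theorem rpow_half_le_of_pow_five_le {L A H K θ : ℝ} (hL : 0 ≤ L) (hA : 0 ≤ A) (hK : 0 ≤ K)
    (hLH : L ≤ H) (h5 : L ^ 5 ≤ K * A ^ 2 * H) (hθ : 1 / 5 < θ) (hθ1 : θ ≤ 1) :
    L ^ ((1 : ℝ) / 2) ≤ K ^ ((1 - θ) / 8) * A ^ ((1 - θ) / 4) * H ^ (θ / 2) := by
  have hH : 0 ≤ H := hL.trans hLH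
  have hs : 0 ≤ (1 - θ) / 8 := by linarith
  have ht : 0 < 1 / 2 - 5 * ((1 - θ) / 8) := by linarith
  calc L ^ ((1 : ℝ) / 2)
      = (L ^ 5) ^ ((1 - θ) / 8) * L ^ (1 / 2 - 5 * ((1 - θ) / 8)) := by
        rw [← Real.rpow_natCast, ← Real.rpow_mul hL,
          ← Real.rpow_add_of_nonneg hL (by positivity) ht.le]
        congr 1
        push_cast
        ring
    _ ≤ (K * A ^ 2 * H) ^ ((1 - θ) / 8) * H ^ (1 / 2 - 5 * ((1 - θ) / 8)) := by
        gcongr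
    _ = K ^ ((1 - θ) / 8) * A ^ ((1 - θ) / 4) *
          (H ^ ((1 - θ) / 8) * H ^ (1 / 2 - 5 * ((1 - θ) / 8))) := by
        rw [Real.mul_rpow (by positivity) hH, Real.mul_rpow hK (by positivity),
          ← Real.rpow_natCast A, ← Real.rpow_mul hA, mul_assoc (_ * _)]
        congr 3
        push_cast
        ring
    _ = K ^ ((1 - θ) / 8) * A ^ ((1 - θ) / 4) * H ^ (θ / 2) := by
        rw [← Real.rpow_add_of_nonneg hH hs ht.le]
        congr 2
        ring

/-- **`M⁴_c`–Sobolev interpolation with the `H¹` norm.**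
For every `θ ∈ (1/4, 1]` there is a constant `C_θ > 0` (depending only on `θ`) such that
for every finitely supported `f : ℤ^{d-1} × ℤ → ℂ` one has
`‖u‖_{L²} ≤ C_θ · ‖u‖_{M⁴_c}^{1-θ} · ‖u‖_{H¹}^{θ}`, where
`‖u‖_{L²}² = Σ_{(w,a)} |f(w,a)|²`, `‖u‖_{M⁴_c}⁴ = Σ_{a,b} |M_f(a,b)|²`, and
`‖u‖_{H¹}² = Σ_{(w,a)} (1+|w|²+a²)|f(w,a)|²`. -/
theorem stmt11 (d : ℕ) (hd : 2 ≤ d) (θ : ℝ) (hθ : 1 / 4 < θ) (hθ1 : θ ≤ 1) :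
    ∃ C : ℝ, 0 < C ∧
      ∀ f : ((Fin (d - 1) → ℤ) × ℤ) → ℂ, (Function.support f).Finite →
        (∑' p : (Fin (d - 1) → ℤ) × ℤ, ‖f p‖ ^ 2) ^ ((1 : ℝ) / 2) ≤
          C * (∑' p : ℤ × ℤ, ‖Mf d f p.1 p.2‖ ^ 2) ^ ((1 - θ) / 4) *
            (∑' p : (Fin (d - 1) → ℤ) × ℤ,
              (1 + (∑ i, (p.1 i : ℝ) ^ 2) + (p.2 : ℝ) ^ 2) * ‖f p‖ ^ 2) ^ (θ / 2) := by
  classical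
  refine ⟨512 ^ ((1 - θ) / 8), by positivity, fun f hf => ?_⟩
  set T := hf.toFinset.image Prod.fst with hT
  set S := hf.toFinset.image Prod.snd with hS
  have hfT : ∀ w a, w ∉ T → f (w, a) = 0 := by
    intro w a hw
    by_contra h
    exact hw (Finset.mem_image.2 ⟨(w, a), hf.mem_toFinset.2 h, rfl⟩)
  have hfS : ∀ w a, a ∉ S → f (w, a) = 0 := by
    intro w a ha
    by_contra h
    exact ha (Finset.mem_image.2 ⟨(w, a), hf.mem_toFinset.2 h, rfl⟩)
  have hf0 : ∀ p ∉ T ×ˢ S, f p = 0 := by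
    rintro ⟨w, a⟩ hp
    by_cases hw : w ∈ T
    · exact hfS w a fun ha => hp (Finset.mk_mem_product hw ha)
    · exact hfT w a hw
  set x : ℤ → ℝ := fun a => ∑ w ∈ T, ‖f (w, a)‖ ^ 2 with hx
  have hx0 : ∀ a, 0 ≤ x a := fun a => Finset.sum_nonneg fun w _ => sq_nonneg _
  have hL : ∑' p : (Fin (d - 1) → ℤ) × ℤ, ‖f p‖ ^ 2 = ∑ a ∈ S, x a := by
    rw [tsum_eq_sum (s := T ×ˢ S) fun p hp => by simp [hf0 p hp], Finset.sum_product_right]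
  have hH : ∑ a ∈ S, (1 + (a : ℝ) ^ 2) * x a ≤ ∑' p : (Fin (d - 1) → ℤ) × ℤ,
      (1 + (∑ i, (p.1 i : ℝ) ^ 2) + (p.2 : ℝ) ^ 2) * ‖f p‖ ^ 2 := by
    rw [tsum_eq_sum (s := T ×ˢ S) fun p hp => by simp [hf0 p hp], Finset.sum_product_right]
    refine Finset.sum_le_sum fun a _ => ?_
    rw [hx, Finset.mul_sum]
    refine Finset.sum_le_sum fun w _ => mul_le_mul_of_nonneg_right ?_ (sq_nonneg _)
    have : 0 ≤ ∑ i, (w i : ℝ) ^ 2 := Finset.sum_nonneg fun i _ => sq_nonneg _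
    simp only
    linarith
  have hdiag : ∀ a, ‖Mf d f a a‖ = x a := by
    intro a
    have h : Mf d f a a = (x a : ℂ) := by
      rw [Mf, tsum_eq_sum (s := T) fun w hw => by simp [hfT w a hw], hx]
      push_cast
      exact Finset.sum_congr rfl fun w _ => Complex.mul_conj' _
    rw [h, Complex.norm_real, Real.norm_of_nonneg (hx0 a)]
  have hA : ∑ a ∈ S, x a ^ 2 ≤ ∑' p : ℤ × ℤ, ‖Mf d f p.1 p.2‖ ^ 2 := by
    have hM : ∀ p ∉ S ×ˢ S, ‖Mf d f p.1 p.2‖ ^ 2 = 0 := by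
      rintro ⟨a, b⟩ hp
      have h : Mf d f a b = 0 := by
        rw [Mf, ← tsum_zero (α := ℂ) (β := Fin (d - 1) → ℤ)]
        refine tsum_congr fun w => ?_
        by_cases ha : a ∈ S
        · simp [hfS w b fun hb => hp (Finset.mk_mem_product ha hb)]
        · simp [hfS w a ha]
      simp [h]
    rw [tsum_eq_sum hM, Finset.sum_product]
    refine Finset.sum_le_sum fun a ha => ?_
    rw [← hdiag a]
    exact Finset.single_le_sum (f := fun b => ‖Mf d f a b‖ ^ 2) (fun b _ => sq_nonneg _) ha
  have hA0 : 0 ≤ ∑ a ∈ S, x a ^ 2 := Finset.sum_nonneg fun a _ => sq_nonneg _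
  have hL0 : 0 ≤ ∑ a ∈ S, x a := Finset.sum_nonneg fun a _ => hx0 a
  have hLH : ∑ a ∈ S, x a ≤ ∑ a ∈ S, (1 + (a : ℝ) ^ 2) * x a :=
    Finset.sum_le_sum fun a _ => by nlinarith [hx0 a, sq_nonneg (a : ℝ)]
  rw [hL]
  refine rpow_half_le_of_pow_five_le hL0 (hA0.trans hA) (by norm_num) (hLH.trans hH) ?_
    (by linarith) hθ1
  refine (sum_pow_five_le S x hx0).trans ?_
  have hH0 := hL0.trans hLH
  gcongr

end
end

section
/- First Cauchy–Schwarz inequality for the non-local product: for d ≥ 2, c ∈ [d], and any continuous φ, ψ : 𝕋^d → ℝ, one has | ∫_{𝕋^d} 𝒩^c(φ,ψ,φ)(x) ψ(x) dx | ≤ ∫_{𝕋^d} 𝒩^c(ψ,ψ,φ)(x) φ(x) dx (and in particular the right-hand side is nonnegative). -/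
open MeasureTheory

noncomputable section

/-- The `d`-dimensional torus `𝕋^d = (ℝ/ℤ)^d`, with its Haar probability measure. -/
abbrev Torus (d : ℕ) := Fin d → UnitAddCircle

/-- `χ^c(x,y) ∈ 𝕋^d`, with `χ^c(x,y)_i = x_i` for `i ≠ c` and `χ^c(x,y)_c = y_c`. -/
def chiMap {d : ℕ} (c : Fin d) (x y : Torus d) : Torus d :=
  fun i => if i = c then y c else x i

/-- The non-local product `𝒩^c(f,g,h)(x) = ∫_{𝕋^d} f(χ^c(x,y)) g(y) h(χ^c(y,x)) dy`. -/
def Ncal {d : ℕ} (c : Fin d) (f g h : Torus d → ℝ) (x : Torus d) : ℝ :=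
  ∫ y : Torus d, f (chiMap c x y) * g y * h (chiMap c y x)

/-- The inner product `∫ f(a,s) g(b,s) ds` of the slices of `f` and `g` over `a` and `b`. -/
def sliceInner {A S : Type*} [MeasurableSpace S] (ν : Measure S) (f g : A × S → ℝ)
    (a b : A) : ℝ :=
  ∫ s, f (a, s) * g (b, s) ∂ν

theorem sliceInner_comm {A S : Type*} [MeasurableSpace S] (ν : Measure S) (f g : A × S → ℝ)
    (a b : A) : sliceInner ν f g a b = sliceInner ν g f b a := by
  simp only [sliceInner, mul_comm]

theorem Continuous.integrable_of_compactSpace {X : Type*} [TopologicalSpace X] [CompactSpace X]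
    [MeasurableSpace X] [OpensMeasurableSpace X] {μ : Measure X} [IsFiniteMeasure μ]
    {f : X → ℝ} (hf : Continuous f) : Integrable f μ :=
  hf.integrable_of_hasCompactSupport (HasCompactSupport.of_compactSpace f)

section Slices

variable {A S : Type*} [TopologicalSpace A] [T2Space A] [CompactSpace A]
  [SecondCountableTopology A] [TopologicalSpace S] [T2Space S] [CompactSpace S]
  [SecondCountableTopology S] [MeasurableSpace S] [BorelSpace S]
  (ν : Measure S) [IsFiniteMeasure ν]

theorem continuous_sliceInner {f g : A × S → ℝ} (hf : Continuous f) (hg : Continuous g) :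
    Continuous fun p : A × A => sliceInner ν f g p.1 p.2 := by
  simpa [sliceInner] using continuous_parametric_integral_of_continuous (μ := ν)
    (f := fun (p : A × A) s => f (p.1, s) * g (p.2, s)) (by fun_prop) isCompact_univ

variable [MeasurableSpace A] [BorelSpace A] (μ : Measure A) [IsFiniteMeasure μ]

theorem integral_box_eq {f g h k : A × S → ℝ} (hf : Continuous f) (hg : Continuous g)
    (hh : Continuous h) (hk : Continuous k) :
    ∫ x, (∫ y, f (y.1, x.2) * g y * h (x.1, y.2) ∂(μ.prod ν)) * k x ∂(μ.prod ν)
      = ∫ p, sliceInner ν k f p.1 p.2 * sliceInner ν h g p.1 p.2 ∂(μ.prod μ) := by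
  have hG := continuous_sliceInner ν hh hg
  have hK := continuous_sliceInner ν hk hf
  have inner : ∀ x : A × S, (∫ y, f (y.1, x.2) * g y * h (x.1, y.2) ∂(μ.prod ν))
      = ∫ b, f (b, x.2) * sliceInner ν h g x.1 b ∂μ := by
    intro x
    rw [integral_prod _ (Continuous.integrable_of_compactSpace (by fun_prop))]
    refine integral_congr_ae (.of_forall fun b => ?_)
    simp only [sliceInner, ← integral_const_mul]
    refine integral_congr_ae (.of_forall fun t => ?_)
    ring
  have cont : Continuous fun x : A × S => ∫ b, f (b, x.2) * sliceInner ν h g x.1 b ∂μ := by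
    have hGx : Continuous fun q : (A × S) × A => sliceInner ν h g q.1.1 q.2 :=
      hG.comp (f := fun q : (A × S) × A => (q.1.1, q.2)) (by fun_prop)
    simpa using continuous_parametric_integral_of_continuous (μ := μ)
      (f := fun (x : A × S) b => f (b, x.2) * sliceInner ν h g x.1 b)
      ((hf.comp (by fun_prop : Continuous fun q : (A × S) × A => (q.2, q.1.2))).mul hGx)
      isCompact_univ
  simp only [inner]
  rw [integral_prod _ (Continuous.integrable_of_compactSpace (cont.fun_mul hk)),
    integral_prod _ (Continuous.integrable_of_compactSpace (hK.fun_mul hG))]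
  refine integral_congr_ae (.of_forall fun a => ?_)
  simp only [← integral_mul_const]
  rw [integral_integral_swap]
  · refine integral_congr_ae (.of_forall fun b => ?_)
    simp only [sliceInner, ← integral_mul_const]
    refine integral_congr_ae (.of_forall fun s => ?_)
    ring
  · refine Continuous.integrable_of_compactSpace ?_
    have hGa : Continuous fun q : S × A => sliceInner ν h g a q.2 :=
      hG.comp (f := fun q : S × A => (a, q.2)) (by fun_prop)
    exact ((hf.comp (by fun_prop : Continuous fun q : S × A => (q.2, q.1))).mul hGa).mul
      (hk.comp (by fun_prop : Continuous fun q : S × A => (a, q.1)))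

end Slices

theorem abs_integral_mul_swap_le {A : Type*} [MeasurableSpace A] (μ : Measure A) [SFinite μ]
    {G : A × A → ℝ} (hG : Integrable (fun p => G p * G p) (μ.prod μ)) :
    |∫ p, G p.swap * G p ∂(μ.prod μ)| ≤ ∫ p, G p * G p ∂(μ.prod μ) := by
  have hs : Integrable (fun p => G p.swap * G p.swap) (μ.prod μ) := hG.swap
  have he : ∫ p, G p.swap * G p.swap ∂(μ.prod μ) = ∫ p, G p * G p ∂(μ.prod μ) :=
    integral_prod_swap (fun p => G p * G p)
  calc |∫ p, G p.swap * G p ∂(μ.prod μ)|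
      ≤ ∫ p, (G p.swap * G p.swap + G p * G p) / 2 ∂(μ.prod μ) := by
        rw [← Real.norm_eq_abs]
        refine norm_integral_le_of_norm_le ((hs.add hG).div_const 2) (.of_forall fun p => ?_)
        rw [Real.norm_eq_abs, abs_le]
        constructor <;> nlinarith [sq_nonneg (G p.swap + G p), sq_nonneg (G p.swap - G p)]
    _ = ∫ p, G p * G p ∂(μ.prod μ) := by
        rw [integral_div, integral_add hs hG, he]
        ring

theorem chiMap_insertNth {n : ℕ} (c : Fin (n + 1)) (a b : UnitAddCircle) (s t : Torus n) :
    chiMap c (c.insertNth a s : Torus (n + 1)) (c.insertNth b t) = c.insertNth b s := by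
  funext i
  refine Fin.succAboveCases c ?_ (fun j => ?_) i
  · simp [chiMap]
  · simp [chiMap, Fin.succAbove_ne]

theorem integral_torus_succ {n : ℕ} (c : Fin (n + 1)) (F : Torus (n + 1) → ℝ) :
    ∫ x, F x = ∫ p : UnitAddCircle × Torus n, F (c.insertNth p.1 p.2) :=
  ((volume_preserving_piFinSuccAbove (fun _ => UnitAddCircle) c).symm.integral_comp'
    F).symm

theorem integral_Ncal_mul {n : ℕ} (c : Fin (n + 1)) {f g h k : Torus (n + 1) → ℝ}
    (hf : Continuous f) (hg : Continuous g) (hh : Continuous h) (hk : Continuous k) :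
    ∫ x, Ncal c f g h x * k x
      = ∫ p : UnitAddCircle × UnitAddCircle,
          sliceInner volume (fun q : UnitAddCircle × Torus n => k (c.insertNth q.1 q.2))
            (fun q => f (c.insertNth q.1 q.2)) p.1 p.2
          * sliceInner volume (fun q : UnitAddCircle × Torus n => h (c.insertNth q.1 q.2))
            (fun q => g (c.insertNth q.1 q.2)) p.1 p.2 := by
  have hc : Continuous fun q : UnitAddCircle × Torus n =>
      (c.insertNth q.1 q.2 : Torus (n + 1)) := by fun_prop
  simp only [Ncal, integral_torus_succ c, chiMap_insertNth]
  exact integral_box_eq (volume : Measure (Torus n)) (volume : Measure UnitAddCircle)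
    (hf.comp hc) (hg.comp hc) (hh.comp hc) (hk.comp hc)

/-- **First Cauchy–Schwarz inequality for the non-local product.**
For `d ≥ 2`, `c ∈ [d]`, and any continuous `φ, ψ : 𝕋^d → ℝ`, one has
`|∫ 𝒩^c(φ,ψ,φ)(x) ψ(x) dx| ≤ ∫ 𝒩^c(ψ,ψ,φ)(x) φ(x) dx`
(and in particular the right-hand side is nonnegative). -/
theorem stmt12 {d : ℕ} (hd : 2 ≤ d) (c : Fin d) (φ ψ : Torus d → ℝ)
    (hφ : Continuous φ) (hψ : Continuous ψ) :
    |∫ x : Torus d, Ncal c φ ψ φ x * ψ x| ≤ ∫ x : Torus d, Ncal c ψ ψ φ x * φ x := by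
  obtain _ | n := d
  · exact c.elim0
  have hc : Continuous fun q : UnitAddCircle × Torus n =>
      (c.insertNth q.1 q.2 : Torus (n + 1)) := by fun_prop
  rw [integral_Ncal_mul c hφ hψ hφ hψ, integral_Ncal_mul c hψ hψ hφ hφ]
  have hG : Continuous fun p : UnitAddCircle × UnitAddCircle =>
      sliceInner volume (fun q : UnitAddCircle × Torus n => φ (c.insertNth q.1 q.2))
        (fun q => ψ (c.insertNth q.1 q.2)) p.1 p.2 :=
    continuous_sliceInner volume (hφ.comp hc) (hψ.comp hc)
  simp only [sliceInner_comm volume (fun q : UnitAddCircle × Torus n => ψ (c.insertNth q.1 q.2))]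
  exact abs_integral_mul_swap_le (volume : Measure UnitAddCircle)
    (Continuous.integrable_of_compactSpace (hG.fun_mul hG))

end
end

section
/- Fourier representation of the monochrome tensor interaction: for d ≥ 2, c ∈ [d], and any real trigonometric polynomial φ on 𝕋^d with Fourier coefficients φ̂(m) = ∫_{𝕋^d} φ(x) e^{2πi m·x} dx (finitely many nonzero), one has 𝔍^c(φ) = Σ_{a,b ∈ ℤ} | Σ_{w ∈ ℤ^{d−1}} φ̂(ι_c(w,a)) · conj( φ̂(ι_c(w,b)) ) |², where ι_c(w,a) ∈ ℤ^d denotes the Fourier mode with c-th coordinate a and remaining coordinates w. Equivalently, 𝔍^c(φ) = Σ_{m,n,p,q ∈ ℤ^d} δ_{m_c,−n_c} δ_{p_c,−q_c} δ_{m_ĉ,−q_ĉ} δ_{n_ĉ,−p_ĉ} φ̂(m) φ̂(n) φ̂(p) φ̂(q), confirming that ‖φ‖_{M⁴_c}⁴ = 𝔍^c(φ) equals the trace of the square of the Gram (tensor) matrix of φ. -/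
open MeasureTheory

noncomputable section

/-- The monochrome quartic interaction
`𝔍^c(φ) = ∫∫ φ(x) φ(y) φ(χ^c(x,y)) φ(χ^c(y,x)) dx dy`. -/
def Jc {d : ℕ} (c : Fin d) (φ : Torus d → ℝ) : ℝ :=
  ∫ x : Torus d, ∫ y : Torus d, φ x * φ y * φ (chiMap c x y) * φ (chiMap c y x)

/-- The Fourier coefficient `φ̂(m) = ∫_{𝕋^d} φ(x) e^{2πi m·x} dx`, where
`e^{2πi m·x} = ∏_i e^{2πi m_i x_i}` is built from the characters `fourier` of the
unit circle. -/
def fhat {d : ℕ} (φ : Torus d → ℝ) (m : Fin d → ℤ) : ℂ :=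
  ∫ x : Torus d, (φ x : ℂ) * ∏ i, fourier (m i) (x i)

/-- `ι_c(w,a) ∈ ℤ^d` is the Fourier mode with `c`-th coordinate `a` and remaining
coordinates `w ∈ ℤ^{d-1}`. -/
def iotaZ {d : ℕ} (c : Fin d) (a : ℤ) (w : {i : Fin d // i ≠ c} → ℤ) : Fin d → ℤ :=
  fun i => if h : i = c then a else w ⟨i, h⟩

theorem volume_torus_eq_haarAddCircle (ι : Type*) [Fintype ι] :
    @volume (UnitAddTorus ι) (@MeasureSpace.pi ι _ (fun _ => UnitAddCircle)
      fun _ => ⟨AddCircle.haarAddCircle⟩) = volume := by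
  have h : (AddCircle.haarAddCircle : Measure UnitAddCircle) = volume := by
    rw [AddCircle.volume_eq_smul_haarAddCircle, ENNReal.ofReal_one, one_smul]
  exact congrArg (fun μ : Measure UnitAddCircle => Measure.pi fun _ : ι => μ) h

open UnitAddTorus in
theorem integral_mFourier {ι : Type*} [Fintype ι] (k : ι → ℤ) :
    ∫ x : UnitAddTorus ι, mFourier k x = if k = 0 then 1 else 0 := by
  have h := orthonormal_iff_ite.mp (orthonormal_mFourier (d := ι)) 0 k
  simp only [ContinuousMap.inner_toLp, ← mFourier_neg, ← mFourier_add, neg_zero, add_zero,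
    eq_comm (a := (0 : ι → ℤ))] at h
  rw [← volume_torus_eq_haarAddCircle]
  exact h

theorem fhat_eq_mFourierCoeff {d : ℕ} (φ : Torus d → ℝ) (m : Fin d → ℤ) :
    fhat φ m = UnitAddTorus.mFourierCoeff (fun x => (φ x : ℂ)) (-m) := by
  simp only [fhat, UnitAddTorus.mFourierCoeff, neg_neg, smul_eq_mul, UnitAddTorus.mFourier,
    ContinuousMap.coe_mk, mul_comm]
  rw [← volume_torus_eq_haarAddCircle]

theorem fhat_neg {d : ℕ} (φ : Torus d → ℝ) (m : Fin d → ℤ) :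
    fhat φ (-m) = (starRingEnd ℂ) (fhat φ m) := by
  simp only [fhat, ← integral_conj, map_mul, Complex.conj_ofReal, map_prod, ← fourier_neg,
    Pi.neg_apply]

theorem eq_sum_fhat {d : ℕ} {φ : Torus d → ℝ} (hφ : Continuous φ)
    (hfin : (Function.support (fhat φ)).Finite) (x : Torus d) :
    (φ x : ℂ) = ∑ m ∈ hfin.toFinset, fhat φ m * UnitAddTorus.mFourier (-m) x := by
  let f : C(UnitAddTorus (Fin d), ℂ) := ⟨fun x => (φ x : ℂ), by fun_prop⟩
  have hf : ∀ m, UnitAddTorus.mFourierCoeff f m = fhat φ (-m) := fun m => by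
    rw [fhat_eq_mFourierCoeff, neg_neg]; rfl
  have hs : Summable (UnitAddTorus.mFourierCoeff f) := by
    refine summable_of_hasFiniteSupport ((hfin.image Neg.neg).subset fun m hm => ?_)
    exact ⟨-m, by simpa [hf] using hm, neg_neg m⟩
  have h := UnitAddTorus.hasSum_mFourier_series_apply_of_summable hs x
  have h' := (Equiv.neg (Fin d → ℤ)).hasSum_iff.mpr h
  simp only [Function.comp_def, Equiv.neg_apply, hf, neg_neg, smul_eq_mul] at h'
  refine h'.unique (hasSum_sum_of_ne_finset_zero fun m hm => ?_)
  have : fhat φ m = 0 := by simpa using hm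
  simp [this]

/-- The mode at which the variable `x` appears after expanding the factors `φ(x)` and
`φ(χ^c(y,x))`, `φ(χ^c(x,y))` at the modes `m`, `n`, `q`. -/
def spliceMode {d : ℕ} (c : Fin d) (m n q : Fin d → ℤ) : Fin d → ℤ :=
  fun i => if i = c then -m i + -n i else -m i + -q i

theorem spliceMode_eq_zero_iff {d : ℕ} {c : Fin d} {m n q : Fin d → ℤ} :
    spliceMode c m n q = 0 ↔ m c = -n c ∧ ∀ i, i ≠ c → m i = -q i := by
  constructor
  · intro h
    refine ⟨?_, fun i hi => ?_⟩
    · have := congrFun h c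
      simp only [spliceMode, if_true, Pi.zero_apply] at this
      lia
    · have := congrFun h i
      simp only [spliceMode, hi, if_false, Pi.zero_apply] at this
      lia
  · rintro ⟨h, h'⟩
    ext i
    by_cases hi : i = c
    · subst hi; simp [spliceMode, h]
    · simp [spliceMode, hi, h' i hi]

theorem mFourier_mul_chiMap {d : ℕ} (c : Fin d) (m n p q : Fin d → ℤ) (x y : Torus d) :
    UnitAddTorus.mFourier (-m) x * UnitAddTorus.mFourier (-p) y *
        UnitAddTorus.mFourier (-q) (chiMap c x y) * UnitAddTorus.mFourier (-n) (chiMap c y x) =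
      UnitAddTorus.mFourier (spliceMode c m n q) x *
        UnitAddTorus.mFourier (spliceMode c p q n) y := by
  simp only [UnitAddTorus.mFourier, ContinuousMap.coe_mk, ← Finset.prod_mul_distrib]
  refine Finset.prod_congr rfl fun i _ => ?_
  by_cases hi : i = c
  · subst hi
    simp only [chiMap, spliceMode, if_true, Pi.neg_apply, fourier_add]
    ring
  · simp only [chiMap, spliceMode, hi, if_false, Pi.neg_apply, fourier_add]
    ring

theorem integral_integral_mFourier_mul {d : ℕ} (k l : Fin d → ℤ) :
    ∫ x : Torus d, ∫ y : Torus d, UnitAddTorus.mFourier k x * UnitAddTorus.mFourier l y =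
      if k = 0 ∧ l = 0 then (1 : ℂ) else 0 := by
  simp only [integral_const_mul, integral_mul_const]
  erw [integral_mFourier, integral_mFourier]
  split_ifs <;> simp_all

theorem integrable_torus_of_continuous {d : ℕ} {f : Torus d → ℂ} (hf : Continuous f) :
    Integrable f :=
  hf.integrable_of_hasCompactSupport (HasCompactSupport.of_compactSpace f)

/-- The summand of the quadruple Fourier series of `𝔍^c(φ)`. -/
def quarticTerm {d : ℕ} (c : Fin d) (φ : Torus d → ℝ)
    (q : (Fin d → ℤ) × (Fin d → ℤ) × (Fin d → ℤ) × (Fin d → ℤ)) : ℂ :=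
  (if q.1 c = -q.2.1 c ∧ q.2.2.1 c = -q.2.2.2 c ∧
      (∀ i, i ≠ c → q.1 i = -q.2.2.2 i) ∧ (∀ i, i ≠ c → q.2.1 i = -q.2.2.1 i)
    then (1 : ℂ) else 0) *
    fhat φ q.1 * fhat φ q.2.1 * fhat φ q.2.2.1 * fhat φ q.2.2.2

theorem quarticTerm_eq {d : ℕ} (c : Fin d) (φ : Torus d → ℝ) (m n p q : Fin d → ℤ) :
    quarticTerm c φ (m, n, p, q) =
      (fhat φ m * fhat φ n * fhat φ p * fhat φ q) *
        if spliceMode c m n q = 0 ∧ spliceMode c p q n = 0 then (1 : ℂ) else 0 := by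
  have : (spliceMode c m n q = 0 ∧ spliceMode c p q n = 0) ↔
      (m c = -n c ∧ p c = -q c ∧ (∀ i, i ≠ c → m i = -q i) ∧ (∀ i, i ≠ c → n i = -p i)) := by
    simp only [spliceMode_eq_zero_iff, eq_neg_iff_add_eq_zero, add_comm (n _) (p _)]
    tauto
  simp only [quarticTerm, this]
  ring

theorem support_quarticTerm_subset {d : ℕ} (c : Fin d) {φ : Torus d → ℝ}
    (hfin : (Function.support (fhat φ)).Finite) :
    Function.support (quarticTerm c φ) ⊆
      ↑(hfin.toFinset ×ˢ hfin.toFinset ×ˢ hfin.toFinset ×ˢ hfin.toFinset) := by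
  rintro ⟨m, n, p, q⟩ h
  rw [Function.mem_support, quarticTerm_eq] at h
  have h := left_ne_zero_of_mul h
  simp only [ne_eq, mul_eq_zero, not_or] at h
  simp [h]

theorem ofReal_Jc {d : ℕ} (c : Fin d) {φ : Torus d → ℝ} (hφ : Continuous φ)
    (hfin : (Function.support (fhat φ)).Finite) :
    (Jc c φ : ℂ) = ∑' q, quarticTerm c φ q := by
  set S := hfin.toFinset
  have key : ∀ x y : Torus d,
      ((φ x * φ y * φ (chiMap c x y) * φ (chiMap c y x) : ℝ) : ℂ) =
        ∑ q ∈ S ×ˢ S ×ˢ S ×ˢ S,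
          (fhat φ q.1 * fhat φ q.2.1 * fhat φ q.2.2.1 * fhat φ q.2.2.2) *
            (UnitAddTorus.mFourier (spliceMode c q.1 q.2.1 q.2.2.2) x *
              UnitAddTorus.mFourier (spliceMode c q.2.2.1 q.2.2.2 q.2.1) y) := by
    intro x y
    have : φ x * φ y * φ (chiMap c x y) * φ (chiMap c y x) =
        φ x * (φ (chiMap c y x) * (φ y * φ (chiMap c x y))) := by ring
    rw [this]
    push_cast
    simp only [eq_sum_fhat hφ hfin, Finset.sum_mul_sum, ← Finset.sum_product']
    refine Finset.sum_congr rfl fun q _ => ?_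
    rw [← mFourier_mul_chiMap]
    ring
  rw [tsum_eq_sum' (support_quarticTerm_subset c hfin), Jc, ← integral_complex_ofReal]
  simp only [← integral_complex_ofReal, key]
  have h₁ : ∀ x : Torus d, ∫ y : Torus d, ∑ q ∈ S ×ˢ S ×ˢ S ×ˢ S,
      (fhat φ q.1 * fhat φ q.2.1 * fhat φ q.2.2.1 * fhat φ q.2.2.2) *
        (UnitAddTorus.mFourier (spliceMode c q.1 q.2.1 q.2.2.2) x *
          UnitAddTorus.mFourier (spliceMode c q.2.2.1 q.2.2.2 q.2.1) y) =
      ∑ q ∈ S ×ˢ S ×ˢ S ×ˢ S, ∫ y : Torus d,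
        (fhat φ q.1 * fhat φ q.2.1 * fhat φ q.2.2.1 * fhat φ q.2.2.2) *
          (UnitAddTorus.mFourier (spliceMode c q.1 q.2.1 q.2.2.2) x *
            UnitAddTorus.mFourier (spliceMode c q.2.2.1 q.2.2.2 q.2.1) y) := fun x =>
    integral_finsetSum _ fun q _ => integrable_torus_of_continuous (by fun_prop)
  simp only [h₁]
  rw [integral_finsetSum]
  · refine Finset.sum_congr rfl fun ⟨m, n, p, q⟩ _ => ?_
    simp only [quarticTerm_eq, ← integral_integral_mFourier_mul, integral_const_mul]
  · intro q _
    simp only [integral_const_mul]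
    exact integrable_torus_of_continuous (by fun_prop)

theorem iotaZ_self {d : ℕ} (c : Fin d) (a : ℤ) (w : {i : Fin d // i ≠ c} → ℤ) :
    iotaZ c a w c = a := by
  simp [iotaZ]

theorem iotaZ_of_ne {d : ℕ} {c i : Fin d} (hi : i ≠ c) (a : ℤ) (w : {i : Fin d // i ≠ c} → ℤ) :
    iotaZ c a w i = w ⟨i, hi⟩ := by
  simp [iotaZ, hi]

theorem iotaZ_eta {d : ℕ} (c : Fin d) (m : Fin d → ℤ) :
    iotaZ c (m c) (fun i => m i) = m := by
  ext i
  by_cases hi : i = c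
  · subst hi; exact iotaZ_self _ _ _
  · exact iotaZ_of_ne hi _ _

theorem iotaZ_inj {d : ℕ} {c : Fin d} {a b : ℤ} {w v : {i : Fin d // i ≠ c} → ℤ} :
    iotaZ c a w = iotaZ c b v ↔ a = b ∧ w = v := by
  refine ⟨fun h => ⟨by simpa [iotaZ_self] using congrFun h c, funext fun i => ?_⟩, ?_⟩
  · simpa [iotaZ_of_ne i.2] using congrFun h i
  · rintro ⟨rfl, rfl⟩; rfl

/-- The quadruples of modes satisfying the constraints of `𝔍^c`, parametrized by two
`c`-th coordinates and two families of remaining coordinates. -/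
def quarticModes {d : ℕ} (c : Fin d)
    (z : (ℤ × ℤ) × ({i : Fin d // i ≠ c} → ℤ) × ({i : Fin d // i ≠ c} → ℤ)) :
    (Fin d → ℤ) × (Fin d → ℤ) × (Fin d → ℤ) × (Fin d → ℤ) :=
  (iotaZ c z.1.1 z.2.1, -iotaZ c z.1.1 z.2.2, iotaZ c z.1.2 z.2.2, -iotaZ c z.1.2 z.2.1)

theorem quarticModes_injective {d : ℕ} (c : Fin d) : Function.Injective (quarticModes c) := by
  rintro ⟨⟨a, b⟩, w, v⟩ ⟨⟨a', b'⟩, w', v'⟩ h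
  simp only [quarticModes, Prod.mk.injEq, neg_inj, iotaZ_inj] at h
  simp [h]

theorem support_quarticTerm_subset_range {d : ℕ} (c : Fin d) (φ : Torus d → ℝ) :
    Function.support (quarticTerm c φ) ⊆ Set.range (quarticModes c) := by
  rintro ⟨m, n, p, q⟩ h
  have h : m c = -n c ∧ p c = -q c ∧ (∀ i, i ≠ c → m i = -q i) ∧ (∀ i, i ≠ c → n i = -p i) := by
    by_contra hc
    exact h (by simp only [quarticTerm, if_neg hc, zero_mul])
  obtain ⟨h₁, h₂, h₃, h₄⟩ := h
  refine ⟨((m c, p c), (fun i => m i), fun i => p i), ?_⟩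
  simp only [quarticModes, iotaZ_eta, Prod.mk.injEq, true_and]
  constructor
  · ext i
    by_cases hi : i = c
    · subst hi; simp [iotaZ_self, h₁]
    · simp [iotaZ_of_ne hi, h₄ i hi]
  · ext i
    by_cases hi : i = c
    · subst hi; simp [iotaZ_self, h₂]
    · simp [iotaZ_of_ne hi, h₃ i hi]

theorem quarticTerm_quarticModes {d : ℕ} (c : Fin d) (φ : Torus d → ℝ) (a b : ℤ)
    (z : ({i : Fin d // i ≠ c} → ℤ) × ({i : Fin d // i ≠ c} → ℤ)) :
    quarticTerm c φ (quarticModes c ((a, b), z)) =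
      (fhat φ (iotaZ c a z.1) * (starRingEnd ℂ) (fhat φ (iotaZ c b z.1))) *
        (starRingEnd ℂ) (fhat φ (iotaZ c a z.2) *
          (starRingEnd ℂ) (fhat φ (iotaZ c b z.2))) := by
  obtain ⟨w, v⟩ := z
  have h : ∀ i, i ≠ c → iotaZ c a w i = iotaZ c b w i := fun i hi => by
    simp [iotaZ_of_ne hi]
  have h' : ∀ i, i ≠ c → iotaZ c a v i = iotaZ c b v i := fun i hi => by
    simp [iotaZ_of_ne hi]
  rw [quarticTerm, if_pos]
  · simp only [quarticModes, fhat_neg, map_mul, Complex.conj_conj]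
    ring
  · simpa [quarticModes, iotaZ_self] using ⟨h, h'⟩

theorem tsum_quarticTerm {d : ℕ} (c : Fin d) {φ : Torus d → ℝ}
    (hfin : (Function.support (fhat φ)).Finite) :
    ∑' q, quarticTerm c φ q = ∑' p : ℤ × ℤ, ((‖∑' w : {i : Fin d // i ≠ c} → ℤ,
      fhat φ (iotaZ c p.1 w) * (starRingEnd ℂ) (fhat φ (iotaZ c p.2 w))‖ ^ 2 : ℝ) : ℂ) := by
  have hs : Summable (quarticTerm c φ ∘ quarticModes c) := by
    refine (summable_of_hasFiniteSupport ?_).comp_injective (quarticModes_injective c)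
    exact (Finset.finite_toSet _).subset (support_quarticTerm_subset c hfin)
  rw [← (quarticModes_injective c).tsum_eq (support_quarticTerm_subset_range c φ)]
  refine hs.tsum_prod.trans (tsum_congr fun ⟨a, b⟩ => ?_)
  have hg : Summable fun w : {i : Fin d // i ≠ c} → ℤ =>
      fhat φ (iotaZ c a w) * (starRingEnd ℂ) (fhat φ (iotaZ c b w)) := by
    refine summable_of_hasFiniteSupport ((hfin.preimage (f := iotaZ c a) fun w _ v _ h =>
      (iotaZ_inj.mp h).2).subset fun w hw => left_ne_zero_of_mul hw)
  have hp := hs.prod_factor (a, b)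
  simp only [Function.comp_def, quarticTerm_quarticModes] at hp ⊢
  refine (hg.tsum_mul_tsum (hg.map (starRingEnd ℂ) Complex.continuous_conj) hp).symm.trans ?_
  push_cast
  rw [← Complex.mul_conj', Complex.conj_tsum]
  rfl

/-- **Fourier representation of the monochrome tensor interaction.**
For `d ≥ 2`, `c ∈ [d]`, and any real trigonometric polynomial `φ` on `𝕋^d` (a continuous
function with finitely many nonzero Fourier coefficients `φ̂(m) = ∫ φ(x) e^{2πi m·x} dx`),
one has
`𝔍^c(φ) = Σ_{a,b ∈ ℤ} |Σ_{w ∈ ℤ^{d-1}} φ̂(ι_c(w,a)) conj(φ̂(ι_c(w,b)))|²`;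
equivalently,
`𝔍^c(φ) = Σ_{m,n,p,q ∈ ℤ^d} δ_{m_c,-n_c} δ_{p_c,-q_c} δ_{m_ĉ,-q_ĉ} δ_{n_ĉ,-p_ĉ}
  φ̂(m) φ̂(n) φ̂(p) φ̂(q)`,
confirming that `‖φ‖_{M⁴_c}⁴ = 𝔍^c(φ)` equals the trace of the square of the Gram
(tensor) matrix of `φ`. -/
theorem stmt16 {d : ℕ} (hd : 2 ≤ d) (c : Fin d) (φ : Torus d → ℝ)
    (hφ : Continuous φ) (hfin : (Function.support (fhat φ)).Finite) :
    (Jc c φ = ∑' p : ℤ × ℤ,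
        ‖∑' w : {i : Fin d // i ≠ c} → ℤ,
            fhat φ (iotaZ c p.1 w) * (starRingEnd ℂ) (fhat φ (iotaZ c p.2 w))‖ ^ 2) ∧
      ((Jc c φ : ℂ) =
        ∑' q : (Fin d → ℤ) × (Fin d → ℤ) × (Fin d → ℤ) × (Fin d → ℤ),
          (if q.1 c = -q.2.1 c ∧ q.2.2.1 c = -q.2.2.2 c ∧
              (∀ i, i ≠ c → q.1 i = -q.2.2.2 i) ∧ (∀ i, i ≠ c → q.2.1 i = -q.2.2.1 i)
            then (1 : ℂ) else 0) *
            fhat φ q.1 * fhat φ q.2.1 * fhat φ q.2.2.1 * fhat φ q.2.2.2) := by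
  have h : (Jc c φ : ℂ) = ∑' q, quarticTerm c φ q := ofReal_Jc c hφ hfin
  refine ⟨?_, h⟩
  rw [tsum_quarticTerm c hfin, ← Complex.ofReal_tsum] at h
  exact_mod_cast h

end
end

section
/- Summability criterion for the weighted lattice sums governing random-operator regularity: let d > k ≥ 1 be integers, θ ∈ [0,1), and α, β ∈ ℝ. Then the sum Σ_{m ∈ ℤ^k} Σ_{n ∈ ℤ^{d−k}} ⟨m⟩^{2β} ⟨n⟩^{−2α} (1+|m|²+|n|²)^{−1+θ} is finite if and only if the three auxiliary sums Σ_{p ∈ ℤ^d} ⟨p⟩^{2β−2α−2+2θ}, Σ_{n ∈ ℤ^{d−k}} ⟨n⟩^{−2α−2+2θ}, and Σ_{m ∈ ℤ^k} ⟨m⟩^{2β−2+2θ} are all finite; equivalently, if and only if β < α − (d−2)/2 − θ, α > (d−k−2)/2 + θ, and β < −(k−2)/2 − θ. -/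
/-- A sum over `ℤ^ι` diverges if on each dyadic cube `[2^j, 2^(j+1))^ι` its terms are at least
a constant times the reciprocal of the number of points of the cube. -/
lemma not_summable_of_dyadic_le {ι : Type*} [Fintype ι] [Nonempty ι] {f : (ι → ℤ) → ℝ} {C : ℝ}
    (hC : 0 < C)
    (h : ∀ (j : ℕ) (p : ι → ℤ), (∀ i, (2 : ℤ) ^ j ≤ p i ∧ p i < 2 ^ (j + 1)) →
      C * ((4 : ℝ) ^ j) ^ (-((Fintype.card ι : ℝ) / 2)) ≤ f p) : ¬ Summable f := by
  classical
  intro hf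
  obtain ⟨s, hs⟩ := summable_iff_vanishing_norm.1 hf C hC
  let i₀ : ι := Classical.arbitrary ι
  obtain ⟨j, hj⟩ : ∃ j : ℕ, ∀ p ∈ s, p i₀ < 2 ^ j := by
    refine ⟨∑ p ∈ s, (p i₀).toNat, fun p hp => ?_⟩
    have h1 : (p i₀).toNat ≤ ∑ p ∈ s, (p i₀).toNat :=
      Finset.single_le_sum (f := fun p : ι → ℤ => (p i₀).toNat) (fun _ _ => Nat.zero_le _) hp
    have h2 : (p i₀).toNat < 2 ^ (∑ p ∈ s, (p i₀).toNat) := h1.trans_lt Nat.lt_two_pow_self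
    calc p i₀ ≤ ((p i₀).toNat : ℤ) := Int.self_le_toNat _
      _ < 2 ^ (∑ p ∈ s, (p i₀).toNat) := by exact_mod_cast h2
  let t : Finset (ι → ℤ) := Fintype.piFinset fun _ => Finset.Ico ((2 : ℤ) ^ j) (2 ^ (j + 1))
  have ht : ∀ p ∈ t, ∀ i, (2 : ℤ) ^ j ≤ p i ∧ p i < 2 ^ (j + 1) := fun p hp i =>
    Finset.mem_Ico.1 (Fintype.mem_piFinset.1 hp i)
  have hdisj : Disjoint t s := Finset.disjoint_left.2 fun p hp hps =>
    (hj p hps).not_ge (ht p hp i₀).1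
  have hcard : t.card = (2 ^ j) ^ Fintype.card ι := by
    have : ((2 : ℤ) ^ (j + 1) - 2 ^ j).toNat = 2 ^ j := by
      rw [pow_succ, mul_two, add_sub_cancel_right]
      exact_mod_cast Int.toNat_natCast (2 ^ j)
    simp [t, Fintype.card_piFinset, this]
  have hpow : ((4 : ℝ) ^ j) ^ (-((Fintype.card ι : ℝ) / 2)) =
      (((2 : ℝ) ^ j) ^ Fintype.card ι)⁻¹ := by
    rw [show ((4 : ℝ) ^ j) = ((2 : ℝ) ^ j) ^ (2 : ℝ) by
        rw [Real.rpow_two, ← pow_mul, mul_comm, pow_mul]; norm_num,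
      ← Real.rpow_mul (by positivity), ← Real.rpow_natCast _ (Fintype.card ι),
      ← Real.rpow_neg (by positivity)]
    congr 1
    ring
  have hsum : C ≤ ∑ p ∈ t, f p := by
    calc C = t.card • (C * ((4 : ℝ) ^ j) ^ (-((Fintype.card ι : ℝ) / 2))) := by
          rw [hpow, hcard, nsmul_eq_mul]
          push_cast
          field_simp
      _ ≤ ∑ p ∈ t, f p := Finset.card_nsmul_le_sum _ _ _ fun p hp => h j p (ht p hp)
  exact absurd ((le_abs_self _).trans_lt (hs t hdisj)) hsum.not_gt

lemma mul_rpow_le_rpow_of_comparable {X y K : ℝ} (hX : 0 < X) (hXy : X ≤ y) (hyK : y ≤ K * X)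
    (s : ℝ) : K ^ (-|s|) * X ^ s ≤ y ^ s := by
  have h1 : 1 ≤ y / X := (one_le_div hX).2 hXy
  have h2 : y / X ≤ K := (div_le_iff₀ hX).2 hyK
  have h3 : K ^ (-|s|) ≤ (y / X) ^ s :=
    calc K ^ (-|s|) ≤ (y / X) ^ (-|s|) :=
          Real.rpow_le_rpow_of_nonpos (by linarith) h2 (by simp)
      _ ≤ (y / X) ^ s := Real.rpow_le_rpow_of_exponent_le h1 (neg_abs_le s)
  calc K ^ (-|s|) * X ^ s ≤ (y / X) ^ s * X ^ s := by gcongr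
    _ = y ^ s := by rw [← Real.mul_rpow (by linarith) hX.le, div_mul_cancel₀ _ hX.ne']

lemma sum_sq_bounds_of_dyadic {ι : Type*} [Fintype ι] {j : ℕ} {p : ι → ℤ}
    (hp : ∀ i, (2 : ℤ) ^ j ≤ p i ∧ p i < 2 ^ (j + 1)) :
    (Fintype.card ι : ℝ) * 4 ^ j ≤ ∑ i, (p i : ℝ) ^ 2 ∧
      ∑ i, (p i : ℝ) ^ 2 ≤ (Fintype.card ι : ℝ) * (4 * 4 ^ j) := by
  have h1 : ∀ i, (2 : ℝ) ^ j ≤ p i := fun i => by exact_mod_cast (hp i).1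
  have h2 : ∀ i, (p i : ℝ) ≤ 2 ^ (j + 1) := fun i => by exact_mod_cast (hp i).2.le
  have h4 : (4 : ℝ) ^ j = (2 ^ j) ^ 2 := by rw [← pow_mul, mul_comm, pow_mul]; norm_num
  have h0 : (0 : ℝ) < 2 ^ j := by positivity
  constructor
  · rw [← nsmul_eq_mul]
    refine Finset.card_nsmul_le_sum _ _ _ fun i _ => ?_
    rw [h4]
    gcongr
    exact h1 i
  · rw [← nsmul_eq_mul]
    refine Finset.sum_le_card_nsmul _ _ _ fun i _ => ?_
    have := h1 i
    have := h2 i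
    rw [pow_succ] at this
    rw [h4]
    nlinarith

lemma summable_int_one_add_sq_rpow {s : ℝ} (hs : s < -(1 / 2)) :
    Summable fun n : ℤ => (1 + (n : ℝ) ^ 2) ^ s := by
  have h : Summable fun n : ℤ => |(n : ℝ)| ^ (-(-(2 * s))) :=
    Real.summable_abs_int_rpow (by linarith)
  refine h.of_norm_bounded_eventually ?_
  filter_upwards [(Set.finite_singleton (0 : ℤ)).compl_mem_cofinite] with n hn
  have hn0 : 0 < |(n : ℝ)| := abs_pos.2 (by exact_mod_cast hn)
  rw [Real.norm_of_nonneg (by positivity), neg_neg, Real.rpow_mul hn0.le, Real.rpow_two, sq_abs]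
  exact Real.rpow_le_rpow_of_nonpos (sq_pos_of_pos hn0 |>.trans_eq (sq_abs _)) (by linarith)
    (by linarith)

/-- The product of summable nonnegative functions of separate variables is summable. -/
lemma summable_pi_prod {ι κ : Type*} [Fintype ι] {g : κ → ℝ} (hg0 : ∀ n, 0 ≤ g n)
    (hg : Summable g) : Summable fun p : ι → κ => ∏ i, g (p i) := by
  classical
  refine summable_of_sum_le (c := ∏ _i : ι, ∑' n, g n)
    (fun p => Finset.prod_nonneg fun i _ => hg0 _) fun s => ?_
  calc ∑ p ∈ s, ∏ i, g (p i)
      ≤ ∑ p ∈ Fintype.piFinset fun i => s.image fun p => p i, ∏ i, g (p i) :=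
        Finset.sum_le_sum_of_subset_of_nonneg
          (fun p hp => Fintype.mem_piFinset.2 fun i => Finset.mem_image_of_mem _ hp)
          fun p _ _ => Finset.prod_nonneg fun i _ => hg0 _
    _ = ∏ i, ∑ n ∈ s.image fun p => p i, g n := (Finset.prod_univ_sum _ fun _ => g).symm
    _ ≤ ∏ _i : ι, ∑' n, g n := Finset.prod_le_prod
        (fun i _ => Finset.sum_nonneg fun n _ => hg0 n)
        fun i _ => hg.sum_le_tsum _ fun n _ => hg0 n

/-- `∑_{p ∈ ℤ^ι} ⟨p⟩^{2s}` is finite exactly when `2s < -|ι|`. -/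
lemma summable_one_add_sum_sq_rpow_iff {ι : Type*} [Fintype ι] [Nonempty ι] {s : ℝ} :
    Summable (fun p : ι → ℤ => (1 + ∑ i, (p i : ℝ) ^ 2) ^ s) ↔
      s < -((Fintype.card ι : ℝ) / 2) := by
  have hN : (1 : ℝ) ≤ Fintype.card ι := by exact_mod_cast Fintype.card_pos
  constructor
  · contrapose!
    intro hs
    set K : ℝ := 1 + 4 * Fintype.card ι with hK
    refine not_summable_of_dyadic_le (C := K ^ (-|s|)) (by positivity) fun j p hp => ?_
    obtain ⟨hl, hu⟩ := sum_sq_bounds_of_dyadic hp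
    have h1 : (1 : ℝ) ≤ 4 ^ j := one_le_pow₀ (by norm_num)
    calc K ^ (-|s|) * ((4 : ℝ) ^ j) ^ (-((Fintype.card ι : ℝ) / 2))
        ≤ K ^ (-|s|) * ((4 : ℝ) ^ j) ^ s := by
          gcongr
      _ ≤ _ := mul_rpow_le_rpow_of_comparable (by positivity) (by nlinarith) (by nlinarith) s
  · intro hs
    have hs' : s / Fintype.card ι < -(1 / 2) := by
      rw [div_lt_iff₀ (by linarith)]
      linarith
    refine (summable_pi_prod (ι := ι) (fun n => by positivity)
      (summable_int_one_add_sq_rpow hs')).of_nonneg_of_le (fun p => by positivity) fun p => ?_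
    calc (1 + ∑ i, (p i : ℝ) ^ 2) ^ s
        = ∏ _i : ι, (1 + ∑ i, (p i : ℝ) ^ 2) ^ (s / Fintype.card ι) := by
          rw [Finset.prod_const, Finset.card_univ, ← Real.rpow_mul_natCast (by positivity),
            div_mul_cancel₀ _ (by positivity)]
      _ ≤ ∏ i, (1 + (p i : ℝ) ^ 2) ^ (s / Fintype.card ι) := by
          refine Finset.prod_le_prod (fun i _ => by positivity) fun i _ => ?_
          refine Real.rpow_le_rpow_of_nonpos (by positivity) ?_ (by linarith)
          gcongr
          exact Finset.single_le_sum (f := fun i => (p i : ℝ) ^ 2)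
            (fun _ _ => by positivity) (Finset.mem_univ i)

lemma one_add_add_rpow_neg_le {A B u v : ℝ} (hA : 0 ≤ A) (hB : 0 ≤ B) (hu : 0 ≤ u)
    (hv : 0 ≤ v) : (1 + A + B) ^ (-(u + v)) ≤ (1 + A) ^ (-u) * (1 + B) ^ (-v) := by
  rw [neg_add, Real.rpow_add (by positivity)]
  exact mul_le_mul
    (Real.rpow_le_rpow_of_nonpos (by positivity) (by linarith) (by linarith))
    (Real.rpow_le_rpow_of_nonpos (by positivity) (by linarith) (by linarith))
    (by positivity) (by positivity)

/-- The two-variable lattice sum converges as soon as the mixed weight `-c` can be split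
between the two variables so that both resulting one-variable sums converge. -/
lemma summable_mixed_of_lt {ι κ : Type*} [Fintype ι] [Nonempty ι] [Fintype κ] [Nonempty κ]
    {a b c : ℝ} (hc : 0 < c) (hab : a + b - c < -(((Fintype.card ι : ℝ) + Fintype.card κ) / 2))
    (ha : a - c < -((Fintype.card ι : ℝ) / 2)) (hb : b - c < -((Fintype.card κ : ℝ) / 2)) :
    Summable fun p : (ι → ℤ) × (κ → ℤ) =>
      (1 + ∑ i, (p.1 i : ℝ) ^ 2) ^ a * (1 + ∑ i, (p.2 i : ℝ) ^ 2) ^ b *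
        (1 + (∑ i, (p.1 i : ℝ) ^ 2) + ∑ i, (p.2 i : ℝ) ^ 2) ^ (-c) := by
  obtain ⟨u, hu, hu'⟩ : ∃ u, max 0 (a + (Fintype.card ι : ℝ) / 2) ≤ u ∧
      a + (Fintype.card ι : ℝ) / 2 < u ∧ u ≤ c ∧ u < c - b - (Fintype.card κ : ℝ) / 2 := by
    have : max 0 (a + (Fintype.card ι : ℝ) / 2) < min c (c - b - (Fintype.card κ : ℝ) / 2) := by
      simp only [max_lt_iff, lt_min_iff]
      refine ⟨⟨?_, ?_⟩, ?_, ?_⟩ <;> linarith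
    obtain ⟨u, h1, h2⟩ := exists_between this
    simp only [max_lt_iff, lt_min_iff] at h1 h2
    exact ⟨u, max_le h1.1.le h1.2.le, h1.2, h2.1.le, h2.2⟩
  have h1 := (summable_one_add_sum_sq_rpow_iff (ι := ι) (s := a - u)).2 (by linarith)
  have h2 := (summable_one_add_sum_sq_rpow_iff (ι := κ) (s := b - (c - u))).2 (by linarith)
  refine (h1.mul_of_nonneg h2 (fun _ => by positivity) fun _ => by positivity).of_nonneg_of_le
    (fun p => by positivity) fun p => ?_
  have hA : 0 ≤ ∑ i, (p.1 i : ℝ) ^ 2 := by positivity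
  have hB : 0 ≤ ∑ i, (p.2 i : ℝ) ^ 2 := by positivity
  have h := one_add_add_rpow_neg_le hA hB (le_of_max_le_left hu) (sub_nonneg.2 hu'.2.1)
  rw [add_sub_cancel] at h
  refine (mul_le_mul_of_nonneg_left h (by positivity)).trans_eq ?_
  rw [sub_eq_add_neg a, sub_eq_add_neg b, Real.rpow_add (by positivity),
    Real.rpow_add (by positivity)]
  ring

/-- The diagonal region `|m| ∼ |n|` alone forces a condition on the total weight. -/
lemma lt_of_summable_mixed {ι κ : Type*} [Fintype ι] [Nonempty ι] [Fintype κ] [Nonempty κ]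
    {a b c : ℝ} (h : Summable fun p : (ι → ℤ) × (κ → ℤ) =>
      (1 + ∑ i, (p.1 i : ℝ) ^ 2) ^ a * (1 + ∑ i, (p.2 i : ℝ) ^ 2) ^ b *
        (1 + (∑ i, (p.1 i : ℝ) ^ 2) + ∑ i, (p.2 i : ℝ) ^ 2) ^ c) :
    a + b + c < -(((Fintype.card ι : ℝ) + Fintype.card κ) / 2) := by
  by_contra! hs
  have hN : (1 : ℝ) ≤ Fintype.card ι := by exact_mod_cast Fintype.card_pos
  have hM : (1 : ℝ) ≤ Fintype.card κ := by exact_mod_cast Fintype.card_pos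
  set K : ℝ := 1 + 4 * Fintype.card ι + 4 * Fintype.card κ with hK
  refine not_summable_of_dyadic_le (C := K ^ (-|a|) * K ^ (-|b|) * K ^ (-|c|)) (by positivity)
    (fun j p hp => ?_) ((Equiv.sumArrowEquivProdArrow ι κ ℤ).summable_iff.2 h)
  obtain ⟨hl, hu⟩ := sum_sq_bounds_of_dyadic fun i => hp (Sum.inl i)
  obtain ⟨hl', hu'⟩ := sum_sq_bounds_of_dyadic fun i => hp (Sum.inr i)
  have h1 : (1 : ℝ) ≤ 4 ^ j := one_le_pow₀ (by norm_num)
  have h0 : (0 : ℝ) < 4 ^ j := by positivity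
  calc K ^ (-|a|) * K ^ (-|b|) * K ^ (-|c|) *
        ((4 : ℝ) ^ j) ^ (-((Fintype.card (ι ⊕ κ) : ℝ) / 2))
      ≤ K ^ (-|a|) * K ^ (-|b|) * K ^ (-|c|) * ((4 : ℝ) ^ j) ^ (a + b + c) := by
        gcongr
        simpa using hs
    _ = (K ^ (-|a|) * ((4 : ℝ) ^ j) ^ a) * (K ^ (-|b|) * ((4 : ℝ) ^ j) ^ b) *
          (K ^ (-|c|) * ((4 : ℝ) ^ j) ^ c) := by
        rw [Real.rpow_add h0, Real.rpow_add h0]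
        ring
    _ ≤ _ := by
        refine mul_le_mul (mul_le_mul ?_ ?_ (by positivity) (by positivity)) ?_
          (by positivity) (by positivity) <;>
        refine mul_rpow_le_rpow_of_comparable h0 ?_ ?_ _ <;>
        simp only [Equiv.sumArrowEquivProdArrow, Equiv.coe_fn_mk, Function.comp_apply] <;>
        nlinarith

lemma summable_mixed_iff {ι κ : Type*} [Fintype ι] [Nonempty ι] [Fintype κ] [Nonempty κ]
    {a b c : ℝ} (hc : 0 < c) :
    Summable (fun p : (ι → ℤ) × (κ → ℤ) =>
      (1 + ∑ i, (p.1 i : ℝ) ^ 2) ^ a * (1 + ∑ i, (p.2 i : ℝ) ^ 2) ^ b *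
        (1 + (∑ i, (p.1 i : ℝ) ^ 2) + ∑ i, (p.2 i : ℝ) ^ 2) ^ (-c)) ↔
      a + b - c < -(((Fintype.card ι : ℝ) + Fintype.card κ) / 2) ∧
        b - c < -((Fintype.card κ : ℝ) / 2) ∧ a - c < -((Fintype.card ι : ℝ) / 2) := by
  refine ⟨fun h => ⟨lt_of_summable_mixed h, ?_, ?_⟩,
    fun h => summable_mixed_of_lt hc h.1 h.2.2 h.2.1⟩
  · rw [← summable_one_add_sum_sq_rpow_iff]
    refine (h.comp_injective (Prod.mk_right_injective (0 : ι → ℤ))).congr fun n => ?_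
    simp [sub_eq_add_neg, Real.rpow_add (show 0 < 1 + ∑ i, (n i : ℝ) ^ 2 by positivity)]
  · rw [← summable_one_add_sum_sq_rpow_iff]
    refine (h.comp_injective (Prod.mk_left_injective (0 : κ → ℤ))).congr fun n => ?_
    simp [sub_eq_add_neg, Real.rpow_add (show 0 < 1 + ∑ i, (n i : ℝ) ^ 2 by positivity)]


/-- **Summability criterion for the weighted lattice sums governing random-operator
regularity.**  Let `d > k ≥ 1` be integers, `θ ∈ [0,1)`, and `α, β ∈ ℝ`.  Then the sum
`Σ_{m ∈ ℤ^k} Σ_{n ∈ ℤ^{d-k}} ⟨m⟩^{2β} ⟨n⟩^{-2α} ⟨(m,n)⟩^{-2+2θ}` is finite if and only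
if the three auxiliary sums `Σ_{p ∈ ℤ^d} ⟨p⟩^{2β-2α-2+2θ}`,
`Σ_{n ∈ ℤ^{d-k}} ⟨n⟩^{-2α-2+2θ}`, and `Σ_{m ∈ ℤ^k} ⟨m⟩^{2β-2+2θ}` are all finite;
equivalently, if and only if `β < α - (d-2)/2 - θ`, `α > (d-k-2)/2 + θ`, and
`β < -(k-2)/2 - θ`.  Here `⟨m⟩² = 1+|m|²` and `⟨(m,n)⟩² = 1+|m|²+|n|²`, so e.g.
`⟨m⟩^{2β} = (1+|m|²)^β` and `⟨(m,n)⟩^{-2+2θ} = (1+|m|²+|n|²)^{θ-1}`. -/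
theorem stmt17 (d k : ℕ) (hk : 1 ≤ k) (hkd : k < d) (θ : ℝ) (hθ0 : 0 ≤ θ) (hθ1 : θ < 1)
    (α β : ℝ) :
    (Summable (fun p : (Fin k → ℤ) × (Fin (d - k) → ℤ) =>
        (1 + ∑ i, (p.1 i : ℝ) ^ 2) ^ β * (1 + ∑ i, (p.2 i : ℝ) ^ 2) ^ (-α) *
          (1 + (∑ i, (p.1 i : ℝ) ^ 2) + ∑ i, (p.2 i : ℝ) ^ 2) ^ (θ - 1)) ↔
      (Summable (fun p : Fin d → ℤ => (1 + ∑ i, (p i : ℝ) ^ 2) ^ (β - α - 1 + θ)) ∧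
        Summable (fun n : Fin (d - k) → ℤ => (1 + ∑ i, (n i : ℝ) ^ 2) ^ (-α - 1 + θ)) ∧
        Summable (fun m : Fin k → ℤ => (1 + ∑ i, (m i : ℝ) ^ 2) ^ (β - 1 + θ)))) ∧
    (Summable (fun p : (Fin k → ℤ) × (Fin (d - k) → ℤ) =>
        (1 + ∑ i, (p.1 i : ℝ) ^ 2) ^ β * (1 + ∑ i, (p.2 i : ℝ) ^ 2) ^ (-α) *
          (1 + (∑ i, (p.1 i : ℝ) ^ 2) + ∑ i, (p.2 i : ℝ) ^ 2) ^ (θ - 1)) ↔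
      (β < α - ((d : ℝ) - 2) / 2 - θ ∧ ((d : ℝ) - (k : ℝ) - 2) / 2 + θ < α ∧
        β < -(((k : ℝ) - 2) / 2) - θ)) := by
  have : Nonempty (Fin k) := ⟨⟨0, hk⟩⟩
  have : Nonempty (Fin (d - k)) := ⟨⟨0, Nat.sub_pos_of_lt hkd⟩⟩
  have : Nonempty (Fin d) := ⟨⟨0, by omega⟩⟩
  rw [show θ - 1 = -(1 - θ) by ring, summable_mixed_iff (by linarith),
    summable_one_add_sum_sq_rpow_iff, summable_one_add_sum_sq_rpow_iff,
    summable_one_add_sum_sq_rpow_iff]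
  simp only [Fintype.card_fin, Nat.cast_sub hkd.le]
  constructor <;> refine and_congr ?_ (and_congr ?_ ?_) <;> constructor <;> intro h <;> linarith
end
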